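/- arXiv:1812.02037 — 9 statements merged into one kernel-verified Lean document; each statement's English description precedes it below -/
import Mathlib

section
/- Let G be a simple graph and f : V(G) → ℕ. Then G has a connected f-factor if and only if for every partition Q of the vertex set V(G) there exists an f-factor H of G that connects Q. -/
/-- An `f`-factor of `G` is a spanning subgraph `H ≤ G` such that the degree of
every vertex `v` in `H` equals `f v`. -/
def IsFFactor {V : Type*} (G H : SimpleGraph V) (f : V → ℕ) : Prop :=
  H ≤ G ∧ ∀ v : V, (H.neighborSet v).ncard = f v

/-- A spanning subgraph `H` connects a partition `Q` of the vertex set if every nonempty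
proper subset of the vertices that is a union of parts of `Q` is crossed by an edge of `H`. -/
def Connects {V : Type*} [Fintype V] [DecidableEq V] (H : SimpleGraph V)
    (Q : Finpartition (Finset.univ : Finset V)) : Prop :=
  ∀ X : Finset V, X.Nonempty → X ≠ Finset.univ →
    (∀ p ∈ Q.parts, p ⊆ X ∨ Disjoint p X) →
    ∃ u v : V, H.Adj u v ∧ u ∈ X ∧ v ∉ X

theorem SimpleGraph.Connected.connects {V : Type*} [Fintype V] [DecidableEq V]
    {H : SimpleGraph V} (hH : H.Connected) (Q : Finpartition (Finset.univ : Finset V)) :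
    Connects H Q := by
  intro X ⟨u, hu⟩ hX _
  obtain ⟨v, hv⟩ : ∃ v, v ∉ X := by
    by_contra! h
    exact hX (Finset.eq_univ_iff_forall.2 h)
  obtain ⟨p⟩ := hH.preconnected u v
  obtain ⟨d, -, hd, hd'⟩ := p.exists_boundary_dart (X : Set V) hu hv
  exact ⟨d.fst, d.snd, d.adj, hd, hd'⟩

theorem Connects.connected_of_bot {V : Type*} [Fintype V] [DecidableEq V] [Nonempty V]
    {H : SimpleGraph V} (hH : Connects H ⊥) : H.Connected := by
  classical
  refine ⟨fun a b => ?_⟩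
  by_contra hab
  obtain ⟨u, v, huv, hu, hv⟩ := hH {x | H.Reachable a x} ⟨a, by simp⟩
    (fun h => hab (by simpa using Finset.eq_univ_iff_forall.1 h b)) (by
      intro p hp
      obtain ⟨x, -, rfl⟩ := Finpartition.mem_bot_iff.1 hp
      rw [Finset.singleton_subset_iff, Finset.disjoint_singleton_left]
      exact em _)
  simp only [Finset.mem_filter_univ] at hu hv
  exact hv (hu.trans huv.reachable)

theorem stmt_6 {V : Type*} [Fintype V] [DecidableEq V] [Nonempty V]
    (G : SimpleGraph V) (f : V → ℕ) :
    (∃ H : SimpleGraph V, IsFFactor G H f ∧ H.Connected) ↔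
      ∀ Q : Finpartition (Finset.univ : Finset V),
        ∃ H : SimpleGraph V, IsFFactor G H f ∧ Connects H Q := by
  refine ⟨fun ⟨H, hf, hH⟩ Q => ⟨H, hf, hH.connects Q⟩, fun h => ?_⟩
  obtain ⟨H, hf, hH⟩ := h ⊥
  exact ⟨H, hf, hH.connected_of_bot⟩
end

section
/- Let G be a simple graph, f : V(G) → ℕ, and let S = (H_0,Q_0),…,(H_k,Q_k) be a maximal sequence satisfying properties (M1)–(M3). Then G has a connected f-factor if and only if H_k is a connected f-factor of G. -/
/-- `P` is the vertex set of a connected component of the subgraph of `H` induced by `R`. -/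
def IsComponentIn {V : Type*} [DecidableEq V] (H : SimpleGraph V) (R P : Finset V) : Prop :=
  P ⊆ R ∧ P.Nonempty ∧ (H.induce (↑P : Set V)).Connected ∧
    ∀ u ∈ P, ∀ v ∈ R, H.Adj u v → v ∈ P

/-- The sequence `(H 0, Q 0), …, (H k, Q k)` satisfies properties (M1)–(M3). -/
def SatisfiesM13 {V : Type*} [Fintype V] [DecidableEq V] (G : SimpleGraph V) (f : V → ℕ)
    (k : ℕ) (H : ℕ → SimpleGraph V) (Q : ℕ → Finpartition (Finset.univ : Finset V)) : Prop :=
  (Q 0).parts = {Finset.univ} ∧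
  (∀ i ≤ k, IsFFactor G (H i) f ∧ Connects (H i) (Q i)) ∧
  ∀ i, 1 ≤ i → i ≤ k →
    (∀ P ∈ (Q i).parts, ∃ R ∈ (Q (i - 1)).parts, IsComponentIn (H (i - 1)) R P) ∧
    Q i ≠ Q (i - 1)

/-- The sequence additionally satisfies property (M4). -/
def SatisfiesM4 {V : Type*} [Fintype V] [DecidableEq V]
    (k : ℕ) (H : ℕ → SimpleGraph V) (Q : ℕ → Finpartition (Finset.univ : Finset V)) : Prop :=
  ∀ i, 1 ≤ i → i ≤ k → ∀ P ∈ (Q i).parts, ∀ v ∈ P,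
    ((((H i).neighborSet v) ∩ ↑P).ncard : ℤ) ≥
      ((((H (i - 1)).neighborSet v) ∩ ↑P).ncard : ℤ) - 2 * (((Q i).parts.card : ℤ) - 1)

/-- The sequence cannot be extended by a further pair while preserving (M1)–(M3). -/
def CannotExtend {V : Type*} [Fintype V] [DecidableEq V] (G : SimpleGraph V) (f : V → ℕ)
    (k : ℕ) (H : ℕ → SimpleGraph V) (Q : ℕ → Finpartition (Finset.univ : Finset V)) : Prop :=
  ∀ (H' : SimpleGraph V) (Q' : Finpartition (Finset.univ : Finset V)),
    ¬ SatisfiesM13 G f (k + 1) (Function.update H (k + 1) H') (Function.update Q (k + 1) Q')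

/-- The subgraph of `H` formed by the edges whose endpoints lie in the same part of `Q`. -/
def withinParts {V : Type*} [Fintype V] [DecidableEq V] (H : SimpleGraph V)
    (Q : Finpartition (Finset.univ : Finset V)) : SimpleGraph V where
  Adj u v := H.Adj u v ∧ Q.part u = Q.part v
  symm := ⟨fun _ _ h => ⟨h.1.symm, h.2.symm⟩⟩
  loopless := ⟨fun _ h => H.loopless.irrefl _ h.1⟩

open Classical in
/-- The partition of the vertex set into the connected components of the subgraphs of `H`
induced by the parts of `Q`. -/
noncomputable def componentPartition {V : Type*} [Fintype V] [DecidableEq V]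
    (H : SimpleGraph V) (Q : Finpartition (Finset.univ : Finset V)) :
    Finpartition (Finset.univ : Finset V) :=
  Finpartition.ofSetoid (withinParts H Q).reachableSetoid

section

variable {V : Type*} [Fintype V] [DecidableEq V] {H : SimpleGraph V}
  {Q : Finpartition (Finset.univ : Finset V)}

theorem withinParts_le : withinParts H Q ≤ H := fun _ _ h => h.1

theorem part_eq_of_reachable_withinParts {u v : V} (h : (withinParts H Q).Reachable u v) :
    Q.part u = Q.part v := by
  obtain ⟨p⟩ := h
  induction p with
  | nil => rfl
  | cons h _ ih => exact h.2.trans ih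

theorem exists_mem_iff_reachable_of_mem_componentPartition {P : Finset V}
    (hP : P ∈ (componentPartition H Q).parts) :
    ∃ v, ∀ w, w ∈ P ↔ (withinParts H Q).Reachable v w := by
  classical
  obtain ⟨v, hv⟩ := (componentPartition H Q).nonempty_of_mem_parts hP
  refine ⟨v, fun w => ?_⟩
  rw [← (componentPartition H Q).part_eq_of_mem hP hv]
  exact Finpartition.mem_part_ofSetoid_iff_rel

theorem isComponentIn_of_mem_componentPartition {P : Finset V}
    (hP : P ∈ (componentPartition H Q).parts) :
    ∃ R ∈ Q.parts, IsComponentIn H R P := by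
  obtain ⟨v, hv⟩ := exists_mem_iff_reachable_of_mem_componentPartition hP
  have hpart : ∀ w ∈ P, Q.part v = Q.part w := fun w hw =>
    part_eq_of_reachable_withinParts ((hv w).1 hw)
  refine ⟨Q.part v, Q.part_mem.2 (Finset.mem_univ v), fun w hw => ?_,
    (componentPartition H Q).nonempty_of_mem_parts hP, ?_, fun u hu w hw h => ?_⟩
  · rw [hpart w hw]
    exact Q.mem_part (Finset.mem_univ w)
  · have hPs : (↑P : Set V) = ((withinParts H Q).connectedComponentMk v).supp := by
      ext w
      rw [Finset.mem_coe, hv w, SimpleGraph.ConnectedComponent.mem_supp_iff,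
        SimpleGraph.ConnectedComponent.eq]
      exact SimpleGraph.reachable_comm
    rw [hPs]
    exact ((withinParts H Q).connectedComponentMk v).connected_toSimpleGraph.mono
      (SimpleGraph.comap_monotone _ withinParts_le)
  · have hw' : Q.part w = Q.part v :=
      Q.part_eq_of_mem (Q.part_mem.2 (Finset.mem_univ v)) hw
    have huw : (withinParts H Q).Adj u w := ⟨h, (hpart u hu).symm.trans hw'.symm⟩
    exact (hv w).2 (((hv u).1 hu).trans huw.reachable)

theorem SimpleGraph.Connected.connects_s7 (hH : H.Connected) : Connects H Q := by
  intro X hX hX' _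
  obtain ⟨u, hu⟩ := hX
  obtain ⟨w, hw⟩ : ∃ w, w ∉ X := by simpa [Finset.eq_univ_iff_forall] using hX'
  obtain ⟨p⟩ := hH.preconnected u w
  obtain ⟨d, -, h₁, h₂⟩ := p.exists_boundary_dart (↑X : Set V) hu hw
  exact ⟨d.fst, d.snd, d.adj, h₁, h₂⟩

theorem Connects.connected_of_componentPartition_eq [Nonempty V] (hH : Connects H Q)
    (hQ : componentPartition H Q = Q) : H.Connected := by
  classical
  refine ⟨fun u w => ?_⟩
  by_contra huw
  let X : Finset V := Finset.univ.filter (H.Reachable u)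
  have hX : ∀ x, x ∈ X ↔ H.Reachable u x := fun x => by simp [X]
  obtain ⟨x, y, hxy, hx, hy⟩ := hH X ⟨u, (hX u).2 (.refl u)⟩
    (fun h => huw ((hX w).1 (h ▸ Finset.mem_univ w))) fun P hP => by
      rw [← hQ] at hP
      obtain ⟨v, hv⟩ := exists_mem_iff_reachable_of_mem_componentPartition hP
      by_cases huv : H.Reachable u v
      · exact .inl fun z hz => (hX z).2 (huv.trans (((hv z).1 hz).mono withinParts_le))
      · exact .inr (Finset.disjoint_left.2 fun z hz hzX => huv
          (((hX z).1 hzX).trans (((hv z).1 hz).mono withinParts_le).symm))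
  exact hy ((hX y).2 (((hX x).1 hx).trans hxy.reachable))

end


theorem stmt_7 {V : Type*} [Fintype V] [DecidableEq V] (G : SimpleGraph V) (f : V → ℕ)
    (k : ℕ) (H : ℕ → SimpleGraph V) (Q : ℕ → Finpartition (Finset.univ : Finset V))
    (hseq : SatisfiesM13 G f k H Q) (hmax : CannotExtend G f k H Q) :
    (∃ H' : SimpleGraph V, IsFFactor G H' f ∧ H'.Connected) ↔
      IsFFactor G (H k) f ∧ (H k).Connected := by
  refine ⟨fun ⟨H', hf, hc⟩ => ?_, fun h => ⟨H k, h⟩⟩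
  obtain ⟨hQ0, hfac, hstep⟩ := hseq
  have := hc.nonempty
  refine ⟨(hfac k le_rfl).1, ?_⟩
  by_contra hcon
  refine hmax H' (componentPartition (H k) (Q k)) ⟨?_, fun i hi => ?_, fun i h1 hi => ?_⟩
  · rwa [Function.update_of_ne (by omega)]
  · rcases hi.lt_or_eq with hi | rfl
    · rw [Function.update_of_ne hi.ne, Function.update_of_ne hi.ne]
      exact hfac i (by omega)
    · rw [Function.update_self, Function.update_self]
      exact ⟨hf, hc.connects_s7⟩
  · rw [Function.update_of_ne (by omega : i - 1 ≠ k + 1),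
      Function.update_of_ne (by omega : i - 1 ≠ k + 1)]
    rcases hi.lt_or_eq with hi | rfl
    · rw [Function.update_of_ne hi.ne]
      exact hstep i h1 (by omega)
    · rw [Function.update_self, Nat.add_sub_cancel]
      exact ⟨fun P hP => isComponentIn_of_mem_componentPartition hP,
        fun h => hcon ((hfac k le_rfl).2.connected_of_componentPartition_eq h)⟩
end

section
/- Let G be a simple graph, f : V(G) → ℕ, and let (H,Q) and (H'',Q') be two consecutive pairs occurring in a sequence satisfying properties (M1)–(M3). Then there exists an f-factor H' of G connecting Q' such that for every part P ∈ Q' and every vertex v ∈ P, |N_{H'}(v) ∩ P| ≥ |N_{H}(v) ∩ P| − 2(|Q'| − 1). -/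
section AltTrail

/-- The graph formed by the steps `w t, w (t + 1)` with `t < m` and `t % 2 = c`. -/
def trailGraph {V : Type*} (w : ℕ → V) (m c : ℕ) : SimpleGraph V where
  Adj a b := a ≠ b ∧ ∃ t < m, t % 2 = c ∧ s(w t, w (t + 1)) = s(a, b)
  symm := ⟨fun a b h => ⟨h.1.symm, by rw [Sym2.eq_swap]; exact h.2⟩⟩

/-- The first `m` steps of `w` alternate between `B` and `R`, starting with `B`, and no edge is
used twice with the same colour. -/
structure IsAltTrail {V : Type*} (R B : SimpleGraph V) (w : ℕ → V) (m : ℕ) : Prop where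
  blue : ∀ t < m, t % 2 = 0 → B.Adj (w t) (w (t + 1))
  red : ∀ t < m, t % 2 = 1 → R.Adj (w t) (w (t + 1))
  inj : ∀ s < m, ∀ t < m, s % 2 = t % 2 → s(w s, w (s + 1)) = s(w t, w (t + 1)) → s = t

namespace IsAltTrail

variable {V : Type*} {R B : SimpleGraph V} {w : ℕ → V} {m : ℕ}

lemma ne (h : IsAltTrail R B w m) {t : ℕ} (ht : t < m) : w t ≠ w (t + 1) := by
  rcases Nat.mod_two_eq_zero_or_one t with h0 | h0
  · exact (h.blue t ht h0).ne
  · exact (h.red t ht h0).ne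

lemma of_succ (h : IsAltTrail R B w (m + 1)) : IsAltTrail R B w m where
  blue t ht := h.blue t (by omega)
  red t ht := h.red t (by omega)
  inj s hs t ht := h.inj s (by omega) t (by omega)

lemma trailGraph_zero_le (h : IsAltTrail R B w m) : trailGraph w m 0 ≤ B := by
  rintro a b ⟨-, t, ht, hc, he⟩
  have := h.blue t ht hc
  rwa [← SimpleGraph.mem_edgeSet, he, SimpleGraph.mem_edgeSet] at this

lemma trailGraph_one_le (h : IsAltTrail R B w m) : trailGraph w m 1 ≤ R := by
  rintro a b ⟨-, t, ht, hc, he⟩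
  have := h.red t ht hc
  rwa [← SimpleGraph.mem_edgeSet, he, SimpleGraph.mem_edgeSet] at this

open Classical in
lemma ncard_neighborSet_succ [Finite V] (h : IsAltTrail R B w (m + 1)) (c : ℕ) (x : V) :
    ((trailGraph w (m + 1) c).neighborSet x).ncard =
      ((trailGraph w m c).neighborSet x).ncard +
        if m % 2 = c then (if w m = x then 1 else 0) + (if w (m + 1) = x then 1 else 0)
        else 0 := by
  have hne := h.ne (Nat.lt_succ_self m)
  split_ifs with hc h1 h2 h2
  · exact absurd (h1.trans h2.symm) hne
  · subst h1
    have hnot : w (m + 1) ∉ (trailGraph w m c).neighborSet (w m) := by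
      rintro ⟨-, t, ht, htc, he⟩
      exact ht.ne (h.inj t (by omega) m (by omega) (by omega) he)
    rw [← Set.ncard_insert_of_notMem hnot (Set.toFinite _)]
    congr 1
    ext y
    simp only [SimpleGraph.mem_neighborSet, trailGraph, Set.mem_insert_iff]
    constructor
    · rintro ⟨hy, t, ht, htc, he⟩
      rcases Nat.lt_succ_iff_lt_or_eq.1 ht with ht | rfl
      · exact Or.inr ⟨hy, t, ht, htc, he⟩
      · left
        rw [Sym2.eq_iff] at he
        grind
    · rintro (rfl | ⟨hy, t, ht, htc, he⟩)
      · exact ⟨hne, m, by omega, hc, rfl⟩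
      · exact ⟨hy, t, by omega, htc, he⟩
  · subst h2
    have hnot : w m ∉ (trailGraph w m c).neighborSet (w (m + 1)) := by
      rintro ⟨-, t, ht, htc, he⟩
      exact ht.ne (h.inj t (by omega) m (by omega) (by omega) (he.trans Sym2.eq_swap))
    rw [zero_add, ← Set.ncard_insert_of_notMem hnot (Set.toFinite _)]
    congr 1
    ext y
    simp only [SimpleGraph.mem_neighborSet, trailGraph, Set.mem_insert_iff]
    constructor
    · rintro ⟨hy, t, ht, htc, he⟩
      rcases Nat.lt_succ_iff_lt_or_eq.1 ht with ht | rfl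
      · exact Or.inr ⟨hy, t, ht, htc, he⟩
      · left
        rw [Sym2.eq_iff] at he
        grind
    · rintro (rfl | ⟨hy, t, ht, htc, he⟩)
      · exact ⟨hne.symm, m, by omega, hc, Sym2.eq_swap⟩
      · exact ⟨hy, t, by omega, htc, he⟩
  · congr 1
    ext y
    simp only [SimpleGraph.mem_neighborSet, trailGraph]
    constructor
    · rintro ⟨hy, t, ht, htc, he⟩
      rcases Nat.lt_succ_iff_lt_or_eq.1 ht with ht | rfl
      · exact ⟨hy, t, ht, htc, he⟩
      · rw [Sym2.eq_iff] at he
        grind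
    · rintro ⟨hy, t, ht, htc, he⟩
      exact ⟨hy, t, by omega, htc, he⟩
  · congr 1
    ext y
    simp only [SimpleGraph.mem_neighborSet, trailGraph]
    constructor
    · rintro ⟨hy, t, ht, htc, he⟩
      rcases Nat.lt_succ_iff_lt_or_eq.1 ht with ht | rfl
      · exact ⟨hy, t, ht, htc, he⟩
      · exact absurd htc hc
    · rintro ⟨hy, t, ht, htc, he⟩
      exact ⟨hy, t, by omega, htc, he⟩

open Classical in
lemma ncard_sub_ncard [Finite V] (h : IsAltTrail R B w m) (x : V) :
    (((trailGraph w m 0).neighborSet x).ncard : ℤ) - ((trailGraph w m 1).neighborSet x).ncard =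
      (if w 0 = x then 1 else 0) - (if m % 2 = 0 then 1 else -1) * (if w m = x then 1 else 0) := by
  induction m with
  | zero =>
    have (c : ℕ) : (trailGraph w 0 c).neighborSet x = ∅ := by
      ext y
      simp [trailGraph]
    simp [this]
  | succ m ih =>
    have := ih h.of_succ
    rw [h.ncard_neighborSet_succ, h.ncard_neighborSet_succ]
    rcases Nat.mod_two_eq_zero_or_one m with h0 | h0
    · have h1 : (m + 1) % 2 = 1 := by omega
      simp only [h0, h1] at this ⊢
      push_cast
      simp at this ⊢
      split_ifs at this ⊢ <;> omega
    · have h1 : (m + 1) % 2 = 0 := by omega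
      simp only [h0, h1] at this ⊢
      push_cast
      simp at this ⊢
      split_ifs at this ⊢ <;> omega

lemma exists_extend [Finite V] (h : IsAltTrail R B w m)
    (hdeg : ∀ x, (R.neighborSet x).ncard = (B.neighborSet x).ncard)
    (hopen : m % 2 = 0 → w m ≠ w 0) :
    ∃ w' : ℕ → V, IsAltTrail R B w' (m + 1) ∧ ∀ t ≤ m, w' t = w t := by
  classical
  have key : ∃ z, (m % 2 = 0 → B.Adj (w m) z) ∧ (m % 2 = 1 → R.Adj (w m) z) ∧
      ¬ (trailGraph w m (m % 2)).Adj (w m) z := by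
    have hcount := h.ncard_sub_ncard (w m)
    have h0 := Set.ncard_le_ncard (s := (trailGraph w m 0).neighborSet (w m))
      (t := B.neighborSet (w m)) (fun y hy => h.trailGraph_zero_le hy) (Set.toFinite _)
    have h1 := Set.ncard_le_ncard (s := (trailGraph w m 1).neighborSet (w m))
      (t := R.neighborSet (w m)) (fun y hy => h.trailGraph_one_le hy) (Set.toFinite _)
    have hd := hdeg (w m)
    rcases Nat.mod_two_eq_zero_or_one m with hm | hm
    · have hw := (hopen hm).symm
      simp only [hm, hw, if_true, if_false] at hcount
      obtain ⟨z, hz, hz'⟩ := Set.exists_mem_notMem_of_ncard_lt_ncard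
        (s := (trailGraph w m 0).neighborSet (w m)) (t := B.neighborSet (w m)) (by omega)
        (Set.toFinite _)
      exact ⟨z, fun _ => hz, by omega, by rw [hm]; exact hz'⟩
    · simp only [hm, if_true] at hcount
      have : (0 : ℤ) ≤ if w 0 = w m then 1 else 0 := by split_ifs <;> simp
      norm_num at hcount
      obtain ⟨z, hz, hz'⟩ := Set.exists_mem_notMem_of_ncard_lt_ncard
        (s := (trailGraph w m 1).neighborSet (w m)) (t := R.neighborSet (w m)) (by omega)
        (Set.toFinite _)
      exact ⟨z, by omega, fun _ => hz, by rw [hm]; exact hz'⟩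
  obtain ⟨z, hzB, hzR, hz⟩ := key
  have hzne : w m ≠ z := by
    rcases Nat.mod_two_eq_zero_or_one m with hm | hm
    · exact (hzB hm).ne
    · exact (hzR hm).ne
  have hnew : ∀ t < m, t % 2 = m % 2 → s(w t, w (t + 1)) ≠ s(w m, z) :=
    fun t ht hc he => hz ⟨hzne, t, ht, hc, he⟩
  have hw : ∀ t ≤ m, (Function.update w (m + 1) z) t = w t := fun t ht => by
    rw [Function.update_of_ne (by omega)]
  have hw1 : Function.update w (m + 1) z (m + 1) = z := Function.update_self ..
  refine ⟨Function.update w (m + 1) z, ⟨?_, ?_, ?_⟩, hw⟩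
  · intro t ht hc
    rcases Nat.lt_succ_iff_lt_or_eq.1 ht with ht | rfl
    · rw [hw t (by omega), hw (t + 1) (by omega)]
      exact h.blue t ht hc
    · rw [hw t le_rfl, hw1]
      exact hzB hc
  · intro t ht hc
    rcases Nat.lt_succ_iff_lt_or_eq.1 ht with ht | rfl
    · rw [hw t (by omega), hw (t + 1) (by omega)]
      exact h.red t ht hc
    · rw [hw t le_rfl, hw1]
      exact hzR hc
  · intro s hs t ht hc he
    rcases Nat.lt_succ_iff_lt_or_eq.1 hs with hs | rfl <;>
    rcases Nat.lt_succ_iff_lt_or_eq.1 ht with ht | rfl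
    · rw [hw t (by omega), hw (t + 1) (by omega), hw s (by omega), hw (s + 1) (by omega)] at he
      exact h.inj s hs t ht hc he
    · rw [hw t le_rfl, hw1, hw s (by omega), hw (s + 1) (by omega)] at he
      exact absurd he (hnew s hs hc)
    · rw [hw s le_rfl, hw1, hw t (by omega), hw (t + 1) (by omega)] at he
      exact absurd he.symm (hnew t ht hc.symm)
    · rfl

lemma length_le [Fintype V] (h : IsAltTrail R B w m) :
    m ≤ Fintype.card (Sym2 V × Bool) := by
  classical
  have := Finset.card_le_card_of_injOn (s := Finset.range m)
    (t := (Finset.univ : Finset (Sym2 V × Bool)))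
    (fun t => (s(w t, w (t + 1)), decide (t % 2 = 0))) (by simp) (by
      intro s hs t ht he
      simp only [Finset.coe_range, Set.mem_Iio] at hs ht
      simp only [Prod.mk.injEq, decide_eq_decide] at he
      exact h.inj s hs t ht (by omega) he.1)
  simpa using this

/-- A repetition at positions of the same parity can be cut out of a trail. -/
lemma cut (h : IsAltTrail R B w m) {i j : ℕ} (hi : 1 ≤ i) (hij : i < j) (hj : j ≤ m)
    (hc : i % 2 = j % 2) (hw : w i = w j) :
    ∃ w' : ℕ → V, IsAltTrail R B w' (m - (j - i)) ∧ w' 0 = w 0 ∧ w' 1 = w 1 ∧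
      w' (m - (j - i)) = w m := by
  set σ : ℕ → ℕ := fun t => if t < i then t else t + (j - i) with hσ
  have hstep : ∀ t, w (σ (t + 1)) = w (σ t + 1) := by
    intro t
    by_cases h1 : t + 1 = i
    · have e1 : σ (t + 1) = j := by simp only [hσ]; split_ifs <;> omega
      have e2 : σ t + 1 = i := by simp only [hσ]; split_ifs <;> omega
      rw [e1, e2, hw]
    · congr 1
      simp only [hσ]
      split_ifs <;> omega
  have hlt : ∀ t < m - (j - i), σ t < m := fun t ht => by
    simp only [hσ]; split_ifs <;> omega
  have hpar : ∀ t, σ t % 2 = t % 2 := fun t => by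
    simp only [hσ]; split_ifs <;> omega
  refine ⟨fun t => w (σ t), ⟨?_, ?_, ?_⟩, ?_, ?_, ?_⟩
  · intro t ht h0
    simp only [hstep]
    exact h.blue _ (hlt t ht) (by rw [hpar, h0])
  · intro t ht h0
    simp only [hstep]
    exact h.red _ (hlt t ht) (by rw [hpar, h0])
  · intro s hs t ht hst he
    simp only [hstep] at he
    have := h.inj _ (hlt s hs) _ (hlt t ht) (by rw [hpar, hpar, hst]) he
    simp only [hσ] at this
    split_ifs at this <;> omega
  · have : σ 0 = 0 := by simp only [hσ]; split_ifs <;> omega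
    simp only [this]
  · have e : σ 0 + 1 = 1 := by simp only [hσ]; split_ifs <;> omega
    simp only
    rw [← e, ← hstep, e]
  · have : σ (m - (j - i)) = m := by simp only [hσ]; split_ifs <;> omega
    simp only [this]

end IsAltTrail

/-- If two graphs have the same degrees, every edge of `B` starts a closed alternating trail that
visits no vertex twice at positive positions of the same parity. -/
lemma exists_closed_altTrail {V : Type*} [Fintype V] {R B : SimpleGraph V}
    (hdeg : ∀ x, (R.neighborSet x).ncard = (B.neighborSet x).ncard) {u v : V} (huv : B.Adj u v) :
    ∃ (w : ℕ → V) (m : ℕ), IsAltTrail R B w m ∧ 1 ≤ m ∧ m % 2 = 0 ∧ w 0 = u ∧ w 1 = v ∧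
      w m = w 0 ∧ ∀ i j, 1 ≤ i → i < j → j ≤ m → i % 2 = j % 2 → w i ≠ w j := by
  classical
  have hex : ∃ m, ∃ w : ℕ → V, IsAltTrail R B w m ∧ 1 ≤ m ∧ m % 2 = 0 ∧ w 0 = u ∧ w 1 = v ∧
      w m = w 0 := by
    by_contra! hno
    have hall : ∀ m, ∃ w : ℕ → V, IsAltTrail R B w (m + 1) ∧ w 0 = u ∧ w 1 = v := by
      intro m
      induction m with
      | zero =>
        refine ⟨fun t => if t = 0 then u else v, ⟨?_, ?_, ?_⟩, by simp, by simp⟩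
        · intro t ht _
          obtain rfl : t = 0 := by omega
          simpa using huv
        · intro t ht _
          omega
        · intro s hs t ht _ _
          omega
      | succ m ih =>
        obtain ⟨w, hw, h0, h1⟩ := ih
        obtain ⟨w', hw', heq⟩ := hw.exists_extend hdeg
          (fun hm => hno (m + 1) w hw (by omega) hm h0 h1)
        exact ⟨w', hw', by rw [heq 0 (by omega), h0], by rw [heq 1 (by omega), h1]⟩
    obtain ⟨w, hw, -⟩ := hall (Fintype.card (Sym2 V × Bool))
    have := hw.length_le
    omega
  obtain ⟨w, hw, hm, hpar, h0, h1, hcl⟩ := Nat.find_spec hex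
  refine ⟨w, _, hw, hm, hpar, h0, h1, hcl, fun i j hi hij hj hc heq => ?_⟩
  obtain ⟨w', hw', h0', h1', hm'⟩ := hw.cut hi hij hj hc heq
  exact Nat.find_min hex (m := Nat.find hex - (j - i)) (by omega)
    ⟨w', hw', by omega, by omega, h0'.trans h0, h1'.trans h1, by
      rw [hm', h0']
      exact hcl⟩

end AltTrail

/-- Given two graphs with the same degrees, an edge of `B` can be added to `R` by a
degree-preserving switch within the symmetric difference that removes at most two edges at each vertex. -/
lemma exists_switch {V : Type*} [Fintype V] {R B : SimpleGraph V}
    (hdeg : ∀ x, (R.neighborSet x).ncard = (B.neighborSet x).ncard) {u v : V} (huv : B.Adj u v)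
    (hR : ¬ R.Adj u v) :
    ∃ H : SimpleGraph V, H ≤ R ⊔ B ∧ R ⊓ B ≤ H ∧ H.Adj u v ∧
      (∀ x, (H.neighborSet x).ncard = (R.neighborSet x).ncard) ∧
      ∀ x, (R.neighborSet x \ H.neighborSet x).ncard ≤ 2 := by
  classical
  have hdeg' : ∀ x, ((R \ B).neighborSet x).ncard = ((B \ R).neighborSet x).ncard := by
    intro x
    have e (G K : SimpleGraph V) :
        (G \ K).neighborSet x = G.neighborSet x \ K.neighborSet x := by
      ext y; simp
    rw [e, e]
    exact (Set.ncard_eq_ncard_iff_ncard_sdiff_eq_ncard_sdiff (Set.toFinite _) (Set.toFinite _)).1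
      (hdeg x)
  obtain ⟨w, m, hw, hm, hpar, h0, h1, hcl, hinj⟩ :=
    exists_closed_altTrail hdeg' (u := u) (v := v) (by simp [huv, hR])
  set T0 := trailGraph w m 0 with hT0
  set T1 := trailGraph w m 1 with hT1
  have hT0le : T0 ≤ B \ R := hw.trailGraph_zero_le
  have hT1le : T1 ≤ R \ B := hw.trailGraph_one_le
  have hbal : ∀ x, (T0.neighborSet x).ncard = (T1.neighborSet x).ncard := by
    intro x
    have := hw.ncard_sub_ncard x
    rw [hcl] at this
    simp only [hpar, if_true, one_mul, sub_self] at this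
    simp only [hT0, hT1]
    omega
  refine ⟨(R \ T1) ⊔ T0, ?_, ?_, ?_, ?_, ?_⟩
  · exact sup_le_sup sdiff_le (hT0le.trans sdiff_le)
  · intro a b hab
    left
    exact ⟨hab.1, fun h => (hT1le h).2 hab.2⟩
  · right
    exact ⟨huv.ne, 0, hm, rfl, by rw [h0, h1]⟩
  · intro x
    have e : ((R \ T1) ⊔ T0).neighborSet x =
        (R.neighborSet x \ T1.neighborSet x) ∪ T0.neighborSet x := by
      ext y; simp
    rw [e, Set.ncard_union_eq _ (Set.toFinite _) (Set.toFinite _), hbal]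
    · exact Set.ncard_sdiff_add_ncard_of_subset (fun y hy => (hT1le hy).1) (Set.toFinite _)
    · rw [Set.disjoint_left]
      exact fun y hy hy' => (hT0le hy').2 hy.1
  · intro x
    set A : Set V := {y | ∃ t < m, t % 2 = 1 ∧ w t = x ∧ w (t + 1) = y} with hA
    set C : Set V := {y | ∃ t < m, t % 2 = 1 ∧ w (t + 1) = x ∧ w t = y} with hC
    have hsub : R.neighborSet x \ ((R \ T1) ⊔ T0).neighborSet x ⊆ A ∪ C := by
      rintro y ⟨hy, hy'⟩
      have hT : T1.Adj x y := by
        by_contra hcon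
        exact hy' (Or.inl ⟨hy, hcon⟩)
      obtain ⟨-, t, ht, hc, he⟩ := hT
      rcases Sym2.eq_iff.1 he with ⟨e1, e2⟩ | ⟨e1, e2⟩
      · exact Or.inl ⟨t, ht, hc, e1, e2⟩
      · exact Or.inr ⟨t, ht, hc, e2, e1⟩
    have huniq : ∀ i j, 1 ≤ i → 1 ≤ j → i ≤ m → j ≤ m → i % 2 = j % 2 → w i = w j → i = j := by
      intro i j hi hj him hjm hc heq
      rcases lt_trichotomy i j with hlt | hlt | hlt
      · exact absurd heq (hinj i j hi hlt hjm hc)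
      · exact hlt
      · exact absurd heq.symm (hinj j i hj hlt him hc.symm)
    have hAc : A.ncard ≤ 1 := by
      refine (Set.ncard_le_one (Set.toFinite _)).2 ?_
      rintro a ⟨s, hs, hs1, hsx, rfl⟩ b ⟨t, ht, ht1, htx, rfl⟩
      rw [huniq s t (by omega) (by omega) hs.le ht.le (by omega) (hsx.trans htx.symm)]
    have hCc : C.ncard ≤ 1 := by
      refine (Set.ncard_le_one (Set.toFinite _)).2 ?_
      rintro a ⟨s, hs, hs1, hsx, rfl⟩ b ⟨t, ht, ht1, htx, rfl⟩
      have := huniq (s + 1) (t + 1) (by omega) (by omega) hs ht (by omega) (hsx.trans htx.symm)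
      rw [Nat.succ.inj this]
    calc _ ≤ (A ∪ C).ncard := Set.ncard_le_ncard hsub (Set.toFinite _)
      _ ≤ A.ncard + C.ncard := Set.ncard_union_le _ _
      _ ≤ 2 := by omega

/-- An `f`-factor can be changed to contain a given set `F` of edges of another `f`-factor, losing
at most `2 * #F` edges at each vertex. -/
lemma IsFFactor.exists_containing {V : Type*} [Fintype V] {G R B : SimpleGraph V} {f : V → ℕ}
    (hR : IsFFactor G R f) (hB : IsFFactor G B f) (F : Finset (Sym2 V))
    (hF : ∀ e ∈ F, e ∈ B.edgeSet) :
    ∃ H : SimpleGraph V, IsFFactor G H f ∧ (∀ e ∈ F, e ∈ H.edgeSet) ∧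
      ∀ x, (R.neighborSet x \ H.neighborSet x).ncard ≤ 2 * F.card := by
  classical
  induction F using Finset.induction_on with
  | empty => exact ⟨R, hR, by simp, by simp⟩
  | insert e F heF ih =>
    obtain ⟨H, hH, hFH, hcard⟩ := ih fun e he => hF e (Finset.mem_insert_of_mem he)
    rw [Finset.card_insert_of_notMem heF]
    by_cases heH : e ∈ H.edgeSet
    · refine ⟨H, hH, ?_, fun x => (hcard x).trans (by omega)⟩
      simpa [heH] using hFH
    · have heB := hF e (Finset.mem_insert_self _ _)
      induction e with | _ u v
      obtain ⟨K, hK1, hK2, hK3, hK4, hK5⟩ := exists_switch (R := H) (B := B)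
        (fun x => by rw [hH.2, hB.2]) heB heH
      refine ⟨K, ⟨hK1.trans (sup_le hH.1 hB.1), fun x => by rw [hK4, hH.2]⟩, ?_, fun x => ?_⟩
      · intro e he
        rcases Finset.mem_insert.1 he with rfl | he'
        · exact hK3
        · have h1 := hFH e he'
          have h2 := hF e he
          induction e with | _ a b
          exact hK2 ⟨h1, h2⟩
      · have hsub : R.neighborSet x \ K.neighborSet x ⊆
            (R.neighborSet x \ H.neighborSet x) ∪ (H.neighborSet x \ K.neighborSet x) := by
          rintro y ⟨h1, h2⟩
          by_cases h : y ∈ H.neighborSet x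
          · exact Or.inr ⟨h, h2⟩
          · exact Or.inl ⟨h1, h⟩
        have h1 := Set.ncard_le_ncard hsub (Set.toFinite _)
        have h2 := Set.ncard_union_le (R.neighborSet x \ H.neighborSet x)
          (H.neighborSet x \ K.neighborSet x)
        have h3 := hcard x
        have h4 := hK5 x
        omega

/-- The quotient of `B` by the partition `Q`. -/
def quotientGraph {V : Type*} [Fintype V] [DecidableEq V] (B : SimpleGraph V)
    (Q : Finpartition (Finset.univ : Finset V)) : SimpleGraph Q.parts where
  Adj p q := p ≠ q ∧ ∃ a ∈ p.1, ∃ b ∈ q.1, B.Adj a b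
  symm := ⟨fun _ _ ⟨h, a, ha, b, hb, hab⟩ => ⟨h.symm, b, hb, a, ha, hab.symm⟩⟩

lemma Connects.quotientGraph_connected {V : Type*} [Fintype V] [DecidableEq V] [Nonempty V]
    {B : SimpleGraph V} {Q : Finpartition (Finset.univ : Finset V)} (h : Connects B Q) :
    (quotientGraph B Q).Connected := by
  classical
  let pt : V → Q.parts := fun v => ⟨Q.part v, Q.part_mem.2 (Finset.mem_univ v)⟩
  have hpt : ∀ (p : Q.parts) (v : V), v ∈ p.1 → pt v = p := fun p v hv =>
    Subtype.ext (Q.part_eq_of_mem p.2 hv)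
  have hmem : ∀ v, v ∈ (pt v).1 := fun v => Q.mem_part (Finset.mem_univ v)
  have : Nonempty Q.parts := ⟨pt (Classical.arbitrary V)⟩
  refine ⟨fun p q => ?_⟩
  by_contra hpq
  obtain ⟨a, ha⟩ := Q.nonempty_of_mem_parts p.2
  obtain ⟨b, hb⟩ := Q.nonempty_of_mem_parts q.2
  obtain ⟨x, y, hxy, hx, hy⟩ := h
    (Finset.univ.filter fun v => (quotientGraph B Q).Reachable p (pt v))
    ⟨a, by simp [hpt p a ha]⟩
    (fun he => hpq (by
      have := he ▸ Finset.mem_univ b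
      simpa [hpt q b hb] using this))
    (fun r hr => by
      by_cases hreach : (quotientGraph B Q).Reachable p ⟨r, hr⟩
      · left
        intro v hv
        simpa [hpt ⟨r, hr⟩ v hv] using hreach
      · right
        rw [Finset.disjoint_left]
        intro v hv
        simpa [hpt ⟨r, hr⟩ v hv] using hreach)
  simp only [Finset.mem_filter, Finset.mem_univ, true_and] at hx hy
  refine hy (hx.trans ?_)
  by_cases hne : pt x = pt y
  · rw [hne]
  · exact SimpleGraph.Adj.reachable ⟨hne, x, hmem x, y, hmem y, hxy⟩

/-- A graph connecting a partition contains at most `#Q.parts - 1` edges that already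
connect it. -/
lemma Connects.exists_finset {V : Type*} [Fintype V] [DecidableEq V] [Nonempty V]
    {B : SimpleGraph V} {Q : Finpartition (Finset.univ : Finset V)} (h : Connects B Q) :
    ∃ F : Finset (Sym2 V), (∀ e ∈ F, e ∈ B.edgeSet) ∧ F.card + 1 ≤ Q.parts.card ∧
      ∀ H : SimpleGraph V, (∀ e ∈ F, e ∈ H.edgeSet) → Connects H Q := by
  classical
  obtain ⟨T, hTle, hT⟩ := h.quotientGraph_connected.exists_isTree_le
  have hrep : ∀ e : Sym2 Q.parts, ∃ e' : Sym2 V, e ∈ T.edgeSet →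
      e' ∈ B.edgeSet ∧ ∃ p q : Q.parts, ∃ a ∈ p.1, ∃ b ∈ q.1, e = s(p, q) ∧ e' = s(a, b) := by
    intro e
    induction e with | _ p q
    by_cases hpq : s(p, q) ∈ T.edgeSet
    · obtain ⟨-, a, ha, b, hb, hab⟩ := hTle hpq
      exact ⟨s(a, b), fun _ => ⟨hab, p, q, a, ha, b, hb, rfl, rfl⟩⟩
    · obtain ⟨v⟩ := ‹Nonempty V›
      exact ⟨s(v, v), fun h => absurd h hpq⟩
  choose g hg using hrep
  refine ⟨T.edgeFinset.image g, ?_, ?_, ?_⟩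
  · intro e he
    obtain ⟨e₀, he₀, rfl⟩ := Finset.mem_image.1 he
    exact (hg e₀ (SimpleGraph.mem_edgeFinset.1 he₀)).1
  · have h1 := hT.card_edgeFinset
    have h2 := Finset.card_image_le (s := T.edgeFinset) (f := g)
    rw [Fintype.card_coe] at h1
    omega
  · intro H hH X ⟨x, hx⟩ hXne hX
    obtain ⟨y, hy⟩ : ∃ y, y ∉ X := by
      by_contra! hall
      exact hXne (Finset.eq_univ_iff_forall.2 hall)
    let pt : V → Q.parts := fun v => ⟨Q.part v, Q.part_mem.2 (Finset.mem_univ v)⟩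
    have hmem : ∀ v, v ∈ (pt v).1 := fun v => Q.mem_part (Finset.mem_univ v)
    have hin : ∀ (p : Q.parts) (v : V), v ∈ p.1 → (p.1 ⊆ X ↔ v ∈ X) := by
      intro p v hv
      refine ⟨fun hp => hp hv, fun hvX => ?_⟩
      rcases hX p.1 p.2 with hp | hp
      · exact hp
      · exact absurd hvX (Finset.disjoint_left.1 hp hv)
    obtain ⟨W⟩ := hT.1.preconnected (pt x) (pt y)
    obtain ⟨d, -, hd1, hd2⟩ := W.exists_boundary_dart {p | p.1 ⊆ X}
      ((hin _ x (hmem x)).2 hx) (fun hc => hy ((hin _ y (hmem y)).1 hc))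
    have hdT : s(d.fst, d.snd) ∈ T.edgeSet := d.adj
    obtain ⟨-, p, q, a, ha, b, hb, he, he'⟩ := hg _ hdT
    have hab : H.Adj a b := by
      rw [← SimpleGraph.mem_edgeSet, ← he']
      exact hH _ (Finset.mem_image_of_mem g (SimpleGraph.mem_edgeFinset.2 hdT))
    rcases Sym2.eq_iff.1 he with ⟨e1, e2⟩ | ⟨e1, e2⟩
    · rw [e1] at hd1
      rw [e2] at hd2
      exact ⟨a, b, hab, (hin p a ha).1 hd1, fun hc => hd2 ((hin q b hb).2 hc)⟩
    · rw [e1] at hd1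
      rw [e2] at hd2
      exact ⟨b, a, hab.symm, (hin q b hb).1 hd1, fun hc => hd2 ((hin p a ha).2 hc)⟩

theorem stmt_8 {V : Type*} [Fintype V] [DecidableEq V] (G : SimpleGraph V) (f : V → ℕ)
    (k : ℕ) (H : ℕ → SimpleGraph V) (Q : ℕ → Finpartition (Finset.univ : Finset V))
    (hseq : SatisfiesM13 G f k H Q) (i : ℕ) (hi1 : 1 ≤ i) (hik : i ≤ k) :
    ∃ H' : SimpleGraph V, IsFFactor G H' f ∧ Connects H' (Q i) ∧
      ∀ P ∈ (Q i).parts, ∀ v ∈ P,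
        (((H'.neighborSet v) ∩ ↑P).ncard : ℤ) ≥
          ((((H (i - 1)).neighborSet v) ∩ ↑P).ncard : ℤ) - 2 * (((Q i).parts.card : ℤ) - 1) := by
  obtain ⟨hB, hconn⟩ := hseq.2.1 i hik
  obtain ⟨hR, -⟩ := hseq.2.1 (i - 1) (by omega)
  rcases isEmpty_or_nonempty V with hV | hV
  · exact ⟨H i, hB, hconn, fun _ _ v => (hV.false v).elim⟩
  obtain ⟨F, hFB, hFcard, hF⟩ := hconn.exists_finset
  obtain ⟨H', hH', hFH', hloss⟩ := hR.exists_containing hB F hFB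
  refine ⟨H', hH', hF H' hFH', fun P _ v _ => ?_⟩
  have hsub : (H (i - 1)).neighborSet v ∩ ↑P ⊆
      (H'.neighborSet v ∩ ↑P) ∪ ((H (i - 1)).neighborSet v \ H'.neighborSet v) := by
    rintro y ⟨h1, h2⟩
    by_cases h : y ∈ H'.neighborSet v
    · exact Or.inl ⟨h, h2⟩
    · exact Or.inr ⟨h1, h⟩
  have h1 := Set.ncard_le_ncard hsub (Set.toFinite _)
  have h2 := Set.ncard_union_le (H'.neighborSet v ∩ ↑P)
    ((H (i - 1)).neighborSet v \ H'.neighborSet v)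
  have h3 := hloss v
  omega
end

section
/- Let g ≥ 1 be a real number, let G be a simple graph on n vertices with n ≥ 6g⁴, let f : V(G) → ℕ satisfy f(v) ≥ n/g for every vertex v, and let S = (H_0,Q_0),…,(H_k,Q_k) be a maximal sequence satisfying properties (M1)–(M4). Then |Q_i| ≤ g + 1 for every i with 0 ≤ i ≤ k, and the number of pairs in the sequence is at most g + 1 (i.e., k + 1 ≤ g + 1). -/
theorem Finpartition.card_parts_lt_of_refines {α : Type*} [DecidableEq α] {s : Finset α}
    {P Q : Finpartition s} (h : ∀ p ∈ P.parts, ∃ q ∈ Q.parts, p ⊆ q) (hne : P ≠ Q) :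
    Q.parts.card < P.parts.card := by
  by_contra! hcard
  choose! φ hφ hsub using h
  have hunique : ∀ p ∈ P.parts, ∀ q ∈ Q.parts, ∀ x ∈ p, x ∈ q → φ p = q := fun p hp q hq x hxp hxq =>
    Q.eq_of_mem_parts (hφ p hp) hq (hsub p hp hxp) hxq
  have hsurj : Set.SurjOn φ P.parts Q.parts := by
    intro q hq
    obtain ⟨x, hx⟩ := Q.nonempty_of_mem_parts hq
    obtain ⟨p, hp, hxp⟩ := P.exists_mem (Q.le hq hx)
    exact ⟨p, hp, hunique p hp q hq x hxp hx⟩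
  have hinj : Set.InjOn φ P.parts := Finset.injOn_of_surjOn_of_card_le φ hφ hsurj hcard
  have hparts : P.parts ⊆ Q.parts := by
    intro p hp
    suffices φ p ⊆ p by
      rw [(hsub p hp).antisymm this]
      exact hφ p hp
    intro x hx
    obtain ⟨p', hp', hxp'⟩ := P.exists_mem (Q.le (hφ p hp) hx)
    rwa [← hinj hp' hp (hunique p' hp' _ (hφ p hp) x hxp' hx)]
  exact hne (Finpartition.ext (Finset.eq_of_subset_of_card_le hparts
    (Finset.card_le_card_of_surjOn φ hsurj)))

theorem Finpartition.card_parts_mul_le {α : Type*} [DecidableEq α] {s : Finset α}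
    (P : Finpartition s) (c : ℝ) (h : ∀ p ∈ P.parts, c ≤ p.card) :
    P.parts.card * c ≤ s.card := by
  rw [← P.sum_card_parts, ← nsmul_eq_mul]
  push_cast
  exact Finset.card_nsmul_le_sum _ _ _ h

theorem IsComponentIn.neighborSet_inter {V : Type*} [DecidableEq V] {H : SimpleGraph V}
    {R P : Finset V} (h : IsComponentIn H R P) {v : V} (hv : v ∈ P) :
    H.neighborSet v ∩ ↑P = H.neighborSet v ∩ ↑R := by
  ext w
  exact and_congr_right fun hw => ⟨fun hwP => h.1 hwP, fun hwR => h.2.2.2 v hv w hwR hw⟩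

theorem card_parts_and_inner_degree_bounds {V : Type*} [Fintype V] [DecidableEq V] {g : ℝ}
    (hg : 1 ≤ g) {G : SimpleGraph V} (hn : 6 * g ^ 4 ≤ (Fintype.card V : ℝ)) {f : V → ℕ}
    (hf : ∀ v : V, (Fintype.card V : ℝ) / g ≤ f v)
    {k : ℕ} {H : ℕ → SimpleGraph V} {Q : ℕ → Finpartition (Finset.univ : Finset V)}
    (hseq : SatisfiesM13 G f k H Q) (hM4 : SatisfiesM4 k H Q) (i : ℕ) (hi : i ≤ k) :
    ((Q i).parts.card : ℝ) ≤ g + 1 ∧ i + 1 ≤ (Q i).parts.card ∧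
      ∀ P ∈ (Q i).parts, ∀ v ∈ P,
        (Fintype.card V : ℝ) / g - 2 * g * i ≤ (((H i).neighborSet v ∩ ↑P).ncard : ℝ) := by
  obtain ⟨h0, hfac, hcomp⟩ := hseq
  induction i with
  | zero =>
    refine ⟨by simp [h0]; linarith, by simp [h0], fun P hP v _ => ?_⟩
    rw [h0, Finset.mem_singleton] at hP
    subst hP
    simpa [(hfac 0 hi).1.2 v] using hf v
  | succ i ih =>
    obtain ⟨hcard, hindex, hdeg⟩ := ih (by omega)
    obtain ⟨hparts, hne⟩ := hcomp (i + 1) (by omega) hi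
    rw [Nat.add_sub_cancel] at hparts hne
    have hlt : (Q i).parts.card < (Q (i + 1)).parts.card :=
      Finpartition.card_parts_lt_of_refines
        (fun P hP => (hparts P hP).imp fun R hR => ⟨hR.1, hR.2.1⟩) hne
    have hold : ∀ P ∈ (Q (i + 1)).parts, ∀ v ∈ P,
        (Fintype.card V : ℝ) / g - 2 * g * i ≤ (((H i).neighborSet v ∩ ↑P).ncard : ℝ) := by
      intro P hP v hv
      obtain ⟨R, hR, hPR⟩ := hparts P hP
      rw [hPR.neighborSet_inter hv]
      exact hdeg R hR v (hPR.1 hv)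
    have hig : (i : ℝ) ≤ g := by
      have : (i : ℝ) + 1 ≤ (Q i).parts.card := by exact_mod_cast hindex
      linarith
    have hsize : ∀ P ∈ (Q (i + 1)).parts,
        (Fintype.card V : ℝ) / g - 2 * g * g ≤ (P.card : ℝ) := by
      intro P hP
      obtain ⟨v, hv⟩ := (Q (i + 1)).nonempty_of_mem_parts hP
      have hle : (((H i).neighborSet v ∩ ↑P).ncard : ℝ) ≤ P.card := by
        rw [← Set.ncard_coe_finset P]
        exact_mod_cast Set.ncard_le_ncard Set.inter_subset_right P.finite_toSet
      have := hold P hP v hv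
      have : 2 * g * i ≤ 2 * g * g := by gcongr
      linarith
    have hnew : ((Q (i + 1)).parts.card : ℝ) ≤ g + 1 := by
      have hsum := (Q (i + 1)).card_parts_mul_le _ hsize
      rw [Finset.card_univ] at hsum
      set n := (Fintype.card V : ℝ)
      set p : ℝ := ((Q (i + 1)).parts.card : ℝ)
      have hsum' : p * (n - 2 * g ^ 3) ≤ n * g := by
        calc p * (n - 2 * g ^ 3) = p * (n / g - 2 * g * g) * g := by field_simp
          _ ≤ n * g := by gcongr
      have hpow : g ^ 3 ≤ g ^ 4 := pow_le_pow_right₀ hg (by norm_num)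
      have hpos : 0 < g ^ 3 := by positivity
      by_contra! hp
      have : (g + 1) * (n - 2 * g ^ 3) ≤ p * (n - 2 * g ^ 3) := by
        gcongr
        linarith
      nlinarith
    refine ⟨hnew, by omega, fun P hP v hv => ?_⟩
    have hloss := hM4 (i + 1) (by omega) hi P hP v hv
    rw [Nat.add_sub_cancel] at hloss
    have hloss' : (((H (i + 1)).neighborSet v ∩ ↑P).ncard : ℝ) ≥
        (((H i).neighborSet v ∩ ↑P).ncard : ℝ) - 2 * (((Q (i + 1)).parts.card : ℝ) - 1) := by
      exact_mod_cast hloss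
    have := hold P hP v hv
    push_cast
    linarith

theorem stmt_10 {V : Type*} [Fintype V] [DecidableEq V] (g : ℝ) (hg : 1 ≤ g)
    (G : SimpleGraph V) (hn : 6 * g ^ 4 ≤ (Fintype.card V : ℝ)) (f : V → ℕ)
    (hf : ∀ v : V, (Fintype.card V : ℝ) / g ≤ f v)
    (k : ℕ) (H : ℕ → SimpleGraph V) (Q : ℕ → Finpartition (Finset.univ : Finset V))
    (hseq : SatisfiesM13 G f k H Q) (hM4 : SatisfiesM4 k H Q)
    (hmax : CannotExtend G f k H Q) :
    (∀ i ≤ k, (((Q i).parts.card : ℝ)) ≤ g + 1) ∧ ((k : ℝ) + 1 ≤ g + 1) := by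
  have hbound := card_parts_and_inner_degree_bounds hg hn hf hseq hM4
  refine ⟨fun i hi => (hbound i hi).1, ?_⟩
  obtain ⟨hcard, hindex, -⟩ := hbound k le_rfl
  have : (k : ℝ) + 1 ≤ (Q k).parts.card := by exact_mod_cast hindex
  linarith
end

section
/- Let A be an alternating circuit and let S be a subset of the edges of A. Then there exists a family M of pairwise edge-disjoint subgraphs of A such that each member of M, with the inherited edge coloring, is a minimal alternating circuit, each member of M contains at least one edge of S, and every edge of S is contained in some member of M. -/
/-- A colored graph `A` (with edge coloring `col`, where `true` stands for red and `false`
for blue) is an alternating circuit if it has a closed walk traversing each edge of `A`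
exactly once in which any two cyclically consecutive edges have different colors. -/
def IsAlternatingCircuit {V : Type*} [DecidableEq V] (A : SimpleGraph V)
    (col : Sym2 V → Bool) : Prop :=
  ∃ (u : V) (w : A.Walk u u), w.IsEulerian ∧ w.edges ≠ [] ∧
    List.Chain' (fun e e' => col e ≠ col e') (w.edges ++ w.edges.take 1)

/-- A minimal alternating circuit is an alternating circuit in which every vertex is
incident with at most two red edges. -/
def IsMinimalAlternatingCircuit {V : Type*} [DecidableEq V] (A : SimpleGraph V)
    (col : Sym2 V → Bool) : Prop :=
  IsAlternatingCircuit A col ∧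
    ∀ v : V, {e ∈ A.edgeSet | v ∈ e ∧ col e = true}.ncard ≤ 2

/-- A list alternates cyclically iff its length is even and the colors of its entries are
determined by the parity of their positions. -/
theorem chain'_append_take_one_iff {α : Type*} (col : α → Bool) (l : List α) (hl : l ≠ []) :
    List.Chain' (fun e e' => col e ≠ col e') (l ++ l.take 1) ↔
      l.length % 2 = 0 ∧ ∀ (i j : ℕ) (hi : i < l.length) (hj : j < l.length),
        col l[i] = col l[j] ↔ i % 2 = j % 2 := by
  have hpos : 0 < l.length := List.length_pos_iff.mpr hl
  have hlen : (l ++ l.take 1).length = l.length + 1 := by simp; omega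
  unfold List.Chain'
  rw [List.isChain_iff_getElem]
  constructor
  · intro h
    have hstep : ∀ i (hi : i + 1 < l.length), col l[i] ≠ col l[i + 1] := by
      intro i hi
      have := h i (by omega)
      rwa [List.getElem_append_left (by omega), List.getElem_append_left (by omega)] at this
    have hlast : col l[l.length - 1] ≠ col l[0] := by
      have := h (l.length - 1) (by omega)
      rw [List.getElem_append_left (by omega), List.getElem_append_right (by omega)] at this
      simpa [Nat.sub_add_cancel hpos] using this
    have hzero : ∀ i (hi : i < l.length), col l[i] = col l[0] ↔ i % 2 = 0 := by
      intro i
      induction i with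
      | zero => simp
      | succ k ih =>
        intro hk
        have h1 := ih (by omega)
        have h2 := hstep k hk
        have h3 : col l[k + 1] = col l[0] ↔ ¬ col l[k] = col l[0] := by
          revert h2
          cases col l[k + 1] <;> cases col l[0] <;> cases col l[k] <;> simp
        rw [h3, h1]
        omega
    refine ⟨?_, fun i j hi hj => ?_⟩
    · have := mt (hzero (l.length - 1) (by omega)).mpr hlast
      omega
    · have h1 := hzero i hi
      have h2 := hzero j hj
      have h3 : col l[i] = col l[j] ↔ (col l[i] = col l[0] ↔ col l[j] = col l[0]) := by
        cases col l[i] <;> cases col l[0] <;> cases col l[j] <;> simp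
      rw [h3, h1, h2]
      omega
  · rintro ⟨heven, h⟩ i hi
    rw [List.getElem_append_left (by omega)]
    by_cases hi' : i + 1 < l.length
    · rw [List.getElem_append_left hi', Ne, h]
      omega
    · rw [List.getElem_append_right (by omega)]
      have : i + 1 - l.length = 0 := by omega
      simp only [this, List.getElem_take, Ne, h]
      omega

/-- Removing a block of even length preserves cyclic alternation. -/
theorem chain'_remove_even {α : Type*} (col : α → Bool) (a b c : List α)
    (hb : b.length % 2 = 0) (hb' : b ≠ []) (hac : a ++ c ≠ [])
    (h : List.Chain' (fun e e' => col e ≠ col e') ((a ++ (b ++ c)) ++ (a ++ (b ++ c)).take 1)) :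
    List.Chain' (fun e e' => col e ≠ col e') (b ++ b.take 1) ∧
      List.Chain' (fun e e' => col e ≠ col e') ((a ++ c) ++ (a ++ c).take 1) := by
  rw [chain'_append_take_one_iff _ _ (by simp [hb'])] at h
  rw [chain'_append_take_one_iff _ _ hb', chain'_append_take_one_iff _ _ hac]
  obtain ⟨h0, h⟩ := h
  simp only [List.length_append] at h0 h ⊢
  refine ⟨⟨hb, fun i j hi hj => ?_⟩, by omega, fun i j hi hj => ?_⟩
  · have := h (a.length + i) (a.length + j) (by omega) (by omega)
    simp [hi, hj] at this
    rw [this]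
    omega
  · have key : ∀ i (hi : i < a.length + c.length),
        ∃ (k : ℕ) (hk : k < a.length + (b.length + c.length)), k % 2 = i % 2 ∧
          (a ++ c)[i]'(by simpa using hi) = (a ++ (b ++ c))[k]'(by simpa using hk) := by
      intro i hi
      by_cases hia : i < a.length
      · exact ⟨i, by omega, rfl, by
          rw [List.getElem_append_left hia, List.getElem_append_left hia]⟩
      · refine ⟨i + b.length, by omega, by omega, ?_⟩
        rw [List.getElem_append_right (by omega), List.getElem_append_right (by omega),
          List.getElem_append_right (by omega)]
        congr 1
        omega
    obtain ⟨k, hk, hki, e1⟩ := key i hi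
    obtain ⟨m, hm, hmj, e2⟩ := key j hj
    rw [e1, e2, h k m hk hm, hki, hmj]

/-- The edges of an alternating closed trail form an alternating circuit. -/
theorem exists_isAlternatingCircuit_of_isTrail {V : Type*} [DecidableEq V] {A : SimpleGraph V}
    {col : Sym2 V → Bool} {u : V} (w : A.Walk u u) (hw : w.edges.Nodup) (hne : w.edges ≠ [])
    (hc : List.Chain' (fun e e' => col e ≠ col e') (w.edges ++ w.edges.take 1)) :
    ∃ B : SimpleGraph V, IsAlternatingCircuit B col ∧ B.edgeSet = {e | e ∈ w.edges} := by
  have hB : (SimpleGraph.fromEdgeSet {e | e ∈ w.edges}).edgeSet = {e | e ∈ w.edges} := by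
    rw [SimpleGraph.edgeSet_fromEdgeSet]
    ext e
    simp only [Set.mem_sdiff, Set.mem_ofPred_eq, and_iff_left_iff_imp]
    exact fun he => A.not_isDiag_of_mem_edgeSet (w.edges_subset_edgeSet he)
  refine ⟨SimpleGraph.fromEdgeSet {e | e ∈ w.edges}, ⟨u, w.transfer _ fun e he => ?_, ?_, ?_, ?_⟩,
    hB⟩
  · rw [hB]; exact he
  · intro e he
    rw [SimpleGraph.Walk.edges_transfer]
    rw [hB] at he
    exact List.count_eq_one_of_mem hw he
  · rwa [SimpleGraph.Walk.edges_transfer]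
  · rwa [SimpleGraph.Walk.edges_transfer]

/-- An alternating closed Eulerian walk that returns to the same vertex after an even, proper
number of steps splits into two edge-disjoint alternating circuits. -/
theorem exists_split {V : Type*} [DecidableEq V] {A : SimpleGraph V}
    {col : Sym2 V → Bool} {u : V} (w : A.Walk u u) (hw : w.IsEulerian)
    (hc : List.Chain' (fun e e' => col e ≠ col e') (w.edges ++ w.edges.take 1))
    {i j : ℕ} (hij : i < j) (hj : j ≤ w.length) (hprop : 0 < i ∨ j < w.length)
    (hpar : i % 2 = j % 2) (hv : w.getVert i = w.getVert j) :
    ∃ B C : SimpleGraph V, IsAlternatingCircuit B col ∧ IsAlternatingCircuit C col ∧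
      Disjoint B.edgeSet C.edgeSet ∧ B.edgeSet ∪ C.edgeSet = A.edgeSet := by
  let p := w.take i
  have hq : (w.drop i).getVert (j - i) = w.getVert i := by
    rw [SimpleGraph.Walk.drop_getVert, hv]
    congr 1
    omega
  let q : A.Walk (w.getVert i) (w.getVert i) := ((w.drop i).take (j - i)).copy rfl hq
  let r : A.Walk (w.getVert i) u := (w.drop j).copy hv.symm rfl
  have hp' : p.edges = w.edges.take i := SimpleGraph.Walk.edges_take _ _
  have hq' : q.edges = (w.edges.drop i).take (j - i) := by
    simp [q, SimpleGraph.Walk.edges_take, SimpleGraph.Walk.edges_drop]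
  have hr' : r.edges = w.edges.drop j := by simp [r, SimpleGraph.Walk.edges_drop]
  have hlen : w.edges.length = w.length := w.length_edges
  have hsplit : w.edges = p.edges ++ (q.edges ++ r.edges) := by
    rw [hp', hq', hr']
    have : w.edges.drop j = (w.edges.drop i).drop (j - i) := by
      rw [List.drop_drop]; congr 1; omega
    rw [this, List.take_append_drop, List.take_append_drop]
  have hpl : p.edges.length = i := by rw [hp', List.length_take]; omega
  have hql : q.edges.length = j - i := by rw [hq', List.length_take, List.length_drop]; omega
  have hrl : r.edges.length = w.length - j := by rw [hr', List.length_drop]; omega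
  have hqne : q.edges ≠ [] := List.ne_nil_of_length_pos (by omega)
  have hprne : p.edges ++ r.edges ≠ [] :=
    List.ne_nil_of_length_pos (by rw [List.length_append]; omega)
  have hnd : w.edges.Nodup := hw.isTrail.edges_nodup
  rw [hsplit] at hc hnd
  obtain ⟨hc1, hc2⟩ := chain'_remove_even col _ _ _ (by omega) hqne hprne hc
  rw [List.nodup_append] at hnd
  obtain ⟨hnp, hnqr, hd1⟩ := hnd
  rw [List.nodup_append] at hnqr
  obtain ⟨hnq, hnr, hd2⟩ := hnqr
  have hpr : (p.append r).edges = p.edges ++ r.edges := SimpleGraph.Walk.edges_append _ _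
  obtain ⟨B, hB, hBe⟩ := exists_isAlternatingCircuit_of_isTrail q hnq hqne hc1
  obtain ⟨C, hC, hCe⟩ := exists_isAlternatingCircuit_of_isTrail (p.append r) (col := col)
    (by
      rw [hpr, List.nodup_append]
      exact ⟨hnp, hnr, fun a ha b hb => hd1 a ha b (List.mem_append_right _ hb)⟩)
    (by rwa [hpr]) (by rwa [hpr])
  refine ⟨B, C, hB, hC, ?_, ?_⟩
  · rw [hBe, hCe, hpr, Set.disjoint_left]
    intro e he he'
    rcases List.mem_append.mp he' with h | h
    · exact hd1 e h e (List.mem_append_left _ he) rfl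
    · exact hd2 e he e h rfl
  · rw [hBe, hCe, hpr]
    ext e
    rw [← hw.mem_edges_iff, hsplit]
    simp only [Set.mem_union, Set.mem_ofPred_eq, List.mem_append]
    tauto

/-- An alternating circuit that is not minimal splits into two edge-disjoint alternating
circuits. -/
theorem IsAlternatingCircuit.exists_split_of_not_minimal {V : Type*} [DecidableEq V]
    {A : SimpleGraph V} {col : Sym2 V → Bool} (hA : IsAlternatingCircuit A col)
    (hmin : ¬ IsMinimalAlternatingCircuit A col) :
    ∃ B C : SimpleGraph V, IsAlternatingCircuit B col ∧ IsAlternatingCircuit C col ∧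
      Disjoint B.edgeSet C.edgeSet ∧ B.edgeSet ∪ C.edgeSet = A.edgeSet := by
  obtain ⟨v, hv⟩ : ∃ v : V, 2 < {e ∈ A.edgeSet | v ∈ e ∧ col e = true}.ncard := by
    by_contra! h
    exact hmin ⟨hA, h⟩
  obtain ⟨u, w, hw, hne, hc⟩ := hA
  have hlen : w.edges.length = w.length := w.length_edges
  have hcol := ((chain'_append_take_one_iff col w.edges hne).mp hc).2
  have hidx : ∀ e ∈ {e ∈ A.edgeSet | v ∈ e ∧ col e = true}, ∃ (k : ℕ) (hk : k < w.edges.length),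
      w.edges[k] = e ∧ col w.edges[k] = true ∧ (v = w.getVert k ∨ v = w.getVert (k + 1)) := by
    rintro e ⟨heA, hve, hce⟩
    obtain ⟨k, hk, rfl⟩ := List.getElem_of_mem (hw.mem_edges_iff.mpr heA)
    refine ⟨k, hk, rfl, hce, ?_⟩
    rwa [SimpleGraph.Walk.getElem_edges, Sym2.mem_iff] at hve
  have leave : ∀ k l (hk : k < w.edges.length) (hl : l < w.edges.length), k < l →
      col w.edges[k] = true → col w.edges[l] = true → v = w.getVert k → v = w.getVert l →
      ∃ B C : SimpleGraph V, IsAlternatingCircuit B col ∧ IsAlternatingCircuit C col ∧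
        Disjoint B.edgeSet C.edgeSet ∧ B.edgeSet ∪ C.edgeSet = A.edgeSet :=
    fun k l hk hl hkl ck cl vk vl => exists_split w hw hc hkl (by omega) (by omega)
      ((hcol k l hk hl).mp (ck.trans cl.symm)) (vk.symm.trans vl)
  have enter : ∀ k l (hk : k < w.edges.length) (hl : l < w.edges.length), k < l →
      col w.edges[k] = true → col w.edges[l] = true →
      v = w.getVert (k + 1) → v = w.getVert (l + 1) →
      ∃ B C : SimpleGraph V, IsAlternatingCircuit B col ∧ IsAlternatingCircuit C col ∧
        Disjoint B.edgeSet C.edgeSet ∧ B.edgeSet ∪ C.edgeSet = A.edgeSet :=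
    fun k l hk hl hkl ck cl vk vl => exists_split w hw hc (Nat.succ_lt_succ hkl) (by omega)
      (by omega) (by have := (hcol k l hk hl).mp (ck.trans cl.symm); omega) (vk.symm.trans vl)
  have hfin : {e ∈ A.edgeSet | v ∈ e ∧ col e = true}.Finite :=
    Set.finite_of_ncard_pos (by omega)
  obtain ⟨a, ha, b, hb, c, hc', hab, hac, hbc⟩ := (Set.two_lt_ncard hfin).mp hv
  obtain ⟨k, hk, ek, ck, vk⟩ := hidx a ha
  obtain ⟨l, hl, el, cl, vl⟩ := hidx b hb
  obtain ⟨m, hm, em, cm, vm⟩ := hidx c hc'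
  have pair : ∀ k l (hk : k < w.edges.length) (hl : l < w.edges.length),
      w.edges[k] ≠ w.edges[l] → col w.edges[k] = true → col w.edges[l] = true →
      (v = w.getVert k ∧ v = w.getVert l ∨ v = w.getVert (k + 1) ∧ v = w.getVert (l + 1)) →
      ∃ B C : SimpleGraph V, IsAlternatingCircuit B col ∧ IsAlternatingCircuit C col ∧
        Disjoint B.edgeSet C.edgeSet ∧ B.edgeSet ∪ C.edgeSet = A.edgeSet := by
    intro k l hk hl hkl ck cl h
    rcases lt_trichotomy k l with hlt | rfl | hlt
    · rcases h with ⟨h1, h2⟩ | ⟨h1, h2⟩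
      · exact leave k l hk hl hlt ck cl h1 h2
      · exact enter k l hk hl hlt ck cl h1 h2
    · exact absurd rfl hkl
    · rcases h with ⟨h1, h2⟩ | ⟨h1, h2⟩
      · exact leave l k hl hk hlt cl ck h2 h1
      · exact enter l k hl hk hlt cl ck h2 h1
  have hpigeon :
      (v = w.getVert k ∧ v = w.getVert l ∨ v = w.getVert (k + 1) ∧ v = w.getVert (l + 1)) ∨
      (v = w.getVert k ∧ v = w.getVert m ∨ v = w.getVert (k + 1) ∧ v = w.getVert (m + 1)) ∨
      (v = w.getVert l ∧ v = w.getVert m ∨ v = w.getVert (l + 1) ∧ v = w.getVert (m + 1)) := by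
    tauto
  rcases hpigeon with h | h | h
  · exact pair k l hk hl (by rwa [ek, el]) ck cl h
  · exact pair k m hk hm (by rwa [ek, em]) ck cm h
  · exact pair l m hl hm (by rwa [el, em]) cl cm h

theorem IsAlternatingCircuit.edgeSet_nonempty {V : Type*} [DecidableEq V] {A : SimpleGraph V}
    {col : Sym2 V → Bool} (hA : IsAlternatingCircuit A col) : A.edgeSet.Nonempty := by
  obtain ⟨u, w, -, hne, -⟩ := hA
  obtain ⟨e, he⟩ := List.exists_mem_of_ne_nil _ hne
  exact ⟨e, w.edges_subset_edgeSet he⟩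

theorem IsAlternatingCircuit.finite_edgeSet {V : Type*} [DecidableEq V] {A : SimpleGraph V}
    {col : Sym2 V → Bool} (hA : IsAlternatingCircuit A col) : A.edgeSet.Finite := by
  obtain ⟨u, w, hw, -, -⟩ := hA
  exact w.edges.finite_toSet.subset fun e he => hw.mem_edges_iff.mpr he

/-- Every alternating circuit decomposes into edge-disjoint minimal alternating circuits. -/
theorem IsAlternatingCircuit.exists_decomposition {V : Type*} [DecidableEq V]
    {A : SimpleGraph V} {col : Sym2 V → Bool} (hA : IsAlternatingCircuit A col) :
    ∃ M : Set (SimpleGraph V), (∀ B ∈ M, B ≤ A) ∧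
      M.Pairwise (fun B B' => Disjoint B.edgeSet B'.edgeSet) ∧
      (∀ B ∈ M, IsMinimalAlternatingCircuit B col) ∧
      ∀ e ∈ A.edgeSet, ∃ B ∈ M, e ∈ B.edgeSet := by
  induction hn : A.edgeSet.ncard using Nat.strong_induction_on generalizing A with
  | _ n ih =>
    by_cases hmin : IsMinimalAlternatingCircuit A col
    · exact ⟨{A}, by simp, by simp, by simpa using hmin, by simp⟩
    obtain ⟨B, C, hB, hC, hdisj, hunion⟩ := hA.exists_split_of_not_minimal hmin
    have hcard : B.edgeSet.ncard + C.edgeSet.ncard = n := by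
      rw [← hn, ← hunion, Set.ncard_union_eq hdisj hB.finite_edgeSet hC.finite_edgeSet]
    have hBpos := (Set.ncard_pos hB.finite_edgeSet).mpr hB.edgeSet_nonempty
    have hCpos := (Set.ncard_pos hC.finite_edgeSet).mpr hC.edgeSet_nonempty
    obtain ⟨M, hM1, hM2, hM3, hM4⟩ := ih _ (by omega) hB rfl
    obtain ⟨N, hN1, hN2, hN3, hN4⟩ := ih _ (by omega) hC rfl
    have hBA : B ≤ A := SimpleGraph.edgeSet_subset_edgeSet.mp (hunion ▸ Set.subset_union_left)
    have hCA : C ≤ A := SimpleGraph.edgeSet_subset_edgeSet.mp (hunion ▸ Set.subset_union_right)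
    refine ⟨M ∪ N, ?_, ?_, ?_, ?_⟩
    · rintro D (hD | hD)
      · exact (hM1 D hD).trans hBA
      · exact (hN1 D hD).trans hCA
    · have hMN : ∀ D ∈ M, ∀ E ∈ N, Disjoint D.edgeSet E.edgeSet := fun D hD E hE =>
        hdisj.mono (SimpleGraph.edgeSet_subset_edgeSet.mpr (hM1 D hD))
          (SimpleGraph.edgeSet_subset_edgeSet.mpr (hN1 E hE))
      rintro D (hD | hD) E (hE | hE) hDE
      · exact hM2 hD hE hDE
      · exact hMN D hD E hE
      · exact (hMN E hE D hD).symm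
      · exact hN2 hD hE hDE
    · rintro D (hD | hD)
      · exact hM3 D hD
      · exact hN3 D hD
    · intro e he
      rw [← hunion] at he
      rcases he with he | he
      · obtain ⟨D, hD, heD⟩ := hM4 e he
        exact ⟨D, Or.inl hD, heD⟩
      · obtain ⟨D, hD, heD⟩ := hN4 e he
        exact ⟨D, Or.inr hD, heD⟩

theorem stmt_13 {V : Type*} [Fintype V] [DecidableEq V] (A : SimpleGraph V)
    (col : Sym2 V → Bool) (hA : IsAlternatingCircuit A col)
    (S : Set (Sym2 V)) (hS : S ⊆ A.edgeSet) :
    ∃ M : Set (SimpleGraph V),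
      (∀ B ∈ M, B ≤ A) ∧
      M.Pairwise (fun B B' => Disjoint B.edgeSet B'.edgeSet) ∧
      (∀ B ∈ M, IsMinimalAlternatingCircuit B col ∧ (S ∩ B.edgeSet).Nonempty) ∧
      ∀ e ∈ S, ∃ B ∈ M, e ∈ B.edgeSet := by
  obtain ⟨M, hle, hpw, hM, hcover⟩ := hA.exists_decomposition
  refine ⟨{B ∈ M | (S ∩ B.edgeSet).Nonempty}, fun B hB => hle B hB.1,
    hpw.mono fun B hB => hB.1, fun B hB => ⟨hM B hB.1, hB.2⟩, fun e he => ?_⟩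
  obtain ⟨B, hB, heB⟩ := hcover e (hS he)
  exact ⟨B, ⟨hB, e, he, heB⟩, heB⟩
end

section
/- Let F be a field of characteristic 2, let G be a simple graph on vertex set {1,…,n}, and let T(G) be the n × n matrix over the multivariate polynomial ring over F in variables x_e, indexed by unordered pairs e of distinct vertices, defined by T(G)(i,j) = x_{{i,j}} if {i,j} is an edge of G and T(G)(i,j) = 0 otherwise. Then det T(G) = Σ_M ∏_{e ∈ M} x_e², where the sum ranges over all perfect matchings M of G; in particular, for every perfect matching M the monomial ∏_{e ∈ M} x_e² has coefficient 1 in det T(G), and every monomial with nonzero coefficient in det T(G) is of this form for some perfect matching M. -/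
/-- `M` is (the edge set of) a perfect matching of `G`: a set of edges of `G` such that
every vertex belongs to exactly one edge of `M`. -/
def IsPMFinset {n : ℕ} (G : SimpleGraph (Fin n)) (M : Finset (Sym2 (Fin n))) : Prop :=
  (↑M ⊆ G.edgeSet) ∧ ∀ v : Fin n, ∃! e, e ∈ M ∧ v ∈ e

/-- In characteristic two, the determinant of a symmetric matrix only sees the involutions. -/
theorem Matrix.IsSymm.det_eq_sum_involutions {ι R : Type*} [Fintype ι] [DecidableEq ι]
    [CommRing R] [CharP R 2] {A : Matrix ι ι R} (hA : A.IsSymm) :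
    A.det = ∑ σ : Equiv.Perm ι with σ⁻¹ = σ, ∏ i, A (σ i) i := by
  have hdet : A.det = ∑ σ : Equiv.Perm ι, ∏ i, A (σ i) i := by
    rw [Matrix.det_apply]
    refine Finset.sum_congr rfl fun σ _ => ?_
    rcases Int.units_eq_one_or (Equiv.Perm.sign σ) with h | h <;>
      simp [h, Units.smul_def, CharTwo.neg_eq]
  rw [hdet, ← Finset.sum_filter_add_sum_filter_not Finset.univ (fun σ : Equiv.Perm ι => σ⁻¹ = σ),
    add_eq_left]
  refine Finset.sum_involution (fun σ _ => σ⁻¹) (fun σ _ => ?_) (fun σ hσ _ => ?_)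
    (fun σ hσ => ?_) (fun σ _ => inv_inv σ)
  · have h : ∏ i, A (σ⁻¹ i) i = ∏ i, A (σ i) i := by
      rw [← Equiv.prod_comp σ]
      refine Finset.prod_congr rfl fun i _ => ?_
      rw [← Equiv.Perm.mul_apply, inv_mul_cancel, Equiv.Perm.one_apply, hA.apply]
    rw [h, CharTwo.add_self_eq_zero]
  · simpa using hσ
  · simpa [eq_comm] using hσ

section PerfectMatching

variable {n : ℕ} {G : SimpleGraph (Fin n)}

/-- The pairs `{σ i, i}`; for a fixed-point-free involution these are its two-cycles. -/
def permPairs (σ : Equiv.Perm (Fin n)) : Finset (Sym2 (Fin n)) :=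
  Finset.univ.image fun i => s(σ i, i)

theorem pair_eq_pair_iff_of_inv_eq {σ : Equiv.Perm (Fin n)} (hσ : σ⁻¹ = σ) (i j : Fin n) :
    s(σ i, i) = s(σ j, j) ↔ i = j ∨ i = σ j := by
  have hinv (k) : σ (σ k) = k := by
    rw [← Equiv.Perm.mul_apply, inv_eq_iff_mul_eq_one.1 hσ, Equiv.Perm.one_apply]
  rw [Sym2.eq_iff]
  constructor
  · rintro (⟨-, h⟩ | ⟨-, h⟩)
    · exact Or.inl h
    · exact Or.inr h
  · rintro (rfl | rfl)
    · simp
    · exact Or.inr ⟨hinv j, rfl⟩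

theorem mem_pair_iff_of_inv_eq {σ : Equiv.Perm (Fin n)} (hσ : σ⁻¹ = σ) (v j : Fin n) :
    v ∈ s(σ j, j) ↔ s(σ j, j) = s(σ v, v) := by
  rw [eq_comm, pair_eq_pair_iff_of_inv_eq hσ, Sym2.mem_iff, or_comm]

theorem isPMFinset_permPairs {σ : Equiv.Perm (Fin n)} (hσ : σ⁻¹ = σ)
    (hG : ∀ i, G.Adj (σ i) i) : IsPMFinset G (permPairs σ) := by
  refine ⟨?_, fun v => ⟨s(σ v, v), ⟨by simp [permPairs], by simp⟩, ?_⟩⟩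
  · intro e he
    obtain ⟨i, -, rfl⟩ := Finset.mem_image.1 (Finset.mem_coe.1 he)
    exact hG i
  · rintro e ⟨he, hv⟩
    obtain ⟨i, -, rfl⟩ := Finset.mem_image.1 he
    exact (mem_pair_iff_of_inv_eq hσ v i).1 hv

theorem eq_of_permPairs_eq {σ τ : Equiv.Perm (Fin n)} (hτ : τ⁻¹ = τ)
    (h : permPairs σ = permPairs τ) : σ = τ := by
  ext1 v
  have hv : s(σ v, v) ∈ permPairs τ := h ▸ Finset.mem_image_of_mem _ (Finset.mem_univ v)
  obtain ⟨i, -, hi⟩ := Finset.mem_image.1 hv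
  have hmem : v ∈ s(τ i, i) := by simp [hi]
  rw [(mem_pair_iff_of_inv_eq hτ v i).1 hmem] at hi
  exact (Sym2.congr_left.1 hi).symm

theorem IsPMFinset.exists_permPairs_eq {M : Finset (Sym2 (Fin n))} (hM : IsPMFinset G M) :
    ∃ σ : Equiv.Perm (Fin n), σ⁻¹ = σ ∧ (∀ i, G.Adj (σ i) i) ∧ permPairs σ = M := by
  have hex (v : Fin n) : ∃ w, s(w, v) ∈ M := by
    obtain ⟨e, ⟨he, hv⟩, -⟩ := hM.2 v
    obtain ⟨w, rfl⟩ := Sym2.mem_iff_exists.1 hv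
    exact ⟨w, Sym2.eq_swap ▸ he⟩
  choose f hf using hex
  have huniq {v w : Fin n} (h : s(w, v) ∈ M) : f v = w :=
    Sym2.congr_left.1 ((hM.2 v).unique ⟨hf v, by simp⟩ ⟨h, by simp⟩)
  have hinv : Function.Involutive f := fun v => huniq (Sym2.eq_swap ▸ hf v)
  refine ⟨hinv.toPerm f, hinv.symm_eq_self_of_involutive, fun i => hM.1 (hf i), ?_⟩
  ext e
  simp only [permPairs, Finset.mem_image, Finset.mem_univ, true_and, Function.Involutive.coe_toPerm]
  constructor
  · rintro ⟨i, rfl⟩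
    exact hf i
  · intro he
    induction e using Sym2.ind with
    | _ w v => exact ⟨v, by rw [huniq he]⟩

theorem prod_pairs_eq_prod_sq {R : Type*} [CommMonoid R] {σ : Equiv.Perm (Fin n)}
    (hσ : σ⁻¹ = σ) (hfix : ∀ i, σ i ≠ i) (f : Sym2 (Fin n) → R) :
    ∏ i, f s(σ i, i) = ∏ e ∈ permPairs σ, f e ^ 2 := by
  rw [Finset.prod_comp f fun i => s(σ i, i)]
  refine Finset.prod_congr rfl fun e he => ?_
  obtain ⟨j, -, rfl⟩ := Finset.mem_image.1 he
  have hfib : (Finset.univ.filter fun i => s(σ i, i) = s(σ j, j)) = {j, σ j} := by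
    ext i
    simp [pair_eq_pair_iff_of_inv_eq hσ, -Sym2.eq]
  rw [hfib, Finset.card_pair (hfix j).symm]

end PerfectMatching

theorem Finset.sum_single_two_injective {α : Type*} [DecidableEq α] :
    Function.Injective fun M : Finset α => ∑ e ∈ M, Finsupp.single e 2 := by
  intro M N h
  ext e
  have he := DFunLike.congr_fun h e
  simp only [Finsupp.finsetSum_apply, Finsupp.single_apply, Finset.sum_ite_eq'] at he
  split_ifs at he <;> simp_all

open scoped Classical in
theorem stmt_15 (F : Type*) [Field F] [CharP F 2] (n : ℕ) (G : SimpleGraph (Fin n)) :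
    let T : Matrix (Fin n) (Fin n) (MvPolynomial (Sym2 (Fin n)) F) :=
      Matrix.of fun i j => if G.Adj i j then MvPolynomial.X s(i, j) else 0
    (T.det =
        ∑ M ∈ Finset.univ.filter (fun M : Finset (Sym2 (Fin n)) => IsPMFinset G M),
          ∏ e ∈ M, MvPolynomial.X e ^ 2) ∧
    (∀ M : Finset (Sym2 (Fin n)), IsPMFinset G M →
        MvPolynomial.coeff (∑ e ∈ M, Finsupp.single e 2) T.det = 1) ∧
    ∀ m : Sym2 (Fin n) →₀ ℕ, MvPolynomial.coeff m T.det ≠ 0 →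
      ∃ M : Finset (Sym2 (Fin n)), IsPMFinset G M ∧ m = ∑ e ∈ M, Finsupp.single e 2 := by
  intro T
  have hsymm : T.IsSymm := by
    ext i j
    simp [T, G.adj_comm i j, Sym2.eq_swap (a := i) (b := j)]
  have hdet : T.det =
      ∑ M ∈ Finset.univ.filter (fun M : Finset (Sym2 (Fin n)) => IsPMFinset G M),
        ∏ e ∈ M, MvPolynomial.X e ^ 2 := by
    rw [hsymm.det_eq_sum_involutions,
      ← Finset.sum_filter_of_ne (p := fun σ : Equiv.Perm (Fin n) => ∀ i, G.Adj (σ i) i)]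
    · refine Finset.sum_bij (fun σ _ => permPairs σ) (fun σ hσ => ?_) (fun σ _ τ hτ h => ?_)
        (fun M hM => ?_) (fun σ hσ => ?_)
      · simp only [Finset.mem_filter, Finset.mem_univ, true_and] at hσ ⊢
        exact isPMFinset_permPairs hσ.1 hσ.2
      · simp only [Finset.mem_filter, Finset.mem_univ, true_and] at hτ
        exact eq_of_permPairs_eq hτ.1 h
      · obtain ⟨σ, h₁, h₂, h₃⟩ := (Finset.mem_filter.1 hM).2.exists_permPairs_eq
        exact ⟨σ, by simp [h₁, h₂], h₃⟩
      · simp only [Finset.mem_filter, Finset.mem_univ, true_and] at hσ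
        rw [← prod_pairs_eq_prod_sq hσ.1 (fun i => (hσ.2 i).ne)]
        exact Finset.prod_congr rfl fun i _ => by simp [T, hσ.2 i]
    · intro σ _ hne i
      by_contra hi
      exact hne (Finset.prod_eq_zero (Finset.mem_univ i) (by simp [T, hi]))
  have hcoeff (m : Sym2 (Fin n) →₀ ℕ) : MvPolynomial.coeff m T.det =
      ∑ M ∈ Finset.univ.filter (fun M : Finset (Sym2 (Fin n)) => IsPMFinset G M),
        if ∑ e ∈ M, Finsupp.single e 2 = m then 1 else 0 := by
    rw [hdet, MvPolynomial.coeff_sum]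
    refine Finset.sum_congr rfl fun M _ => ?_
    simp_rw [MvPolynomial.X_pow_eq_monomial]
    rw [← MvPolynomial.monomial_sum_one, MvPolynomial.coeff_monomial]
  refine ⟨hdet, fun M hM => ?_, fun m hm => ?_⟩
  · rw [hcoeff]
    simp_rw [Finset.sum_single_two_injective.eq_iff]
    simp [hM]
  · rw [hcoeff] at hm
    obtain ⟨M, hM, hne⟩ := Finset.exists_ne_zero_of_sum_ne_zero hm
    exact ⟨M, (Finset.mem_filter.1 hM).2, (of_not_not fun h => hne (if_neg h)).symm⟩
end

section
/- Let F be a field of characteristic 2, let G be a simple graph on vertex set {1,…,n}, and let T(G) be the n × n matrix over the multivariate polynomial ring over F in variables x_e, indexed by unordered pairs e of distinct vertices, defined by T(G)(i,j) = x_{{i,j}} if {i,j} is an edge of G and T(G)(i,j) = 0 otherwise. Then det T(G) is the zero polynomial if and only if G does not have a perfect matching. -/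
/-- An involution moving every vertex along an edge of `G` yields a perfect matching. -/
theorem exists_isPMFinset_of_involutive {n : ℕ} {G : SimpleGraph (Fin n)}
    {f : Fin n → Fin n} (hf : Function.Involutive f) (hG : ∀ i, G.Adj (f i) i) :
    ∃ M : Finset (Sym2 (Fin n)), IsPMFinset G M := by
  refine ⟨Finset.univ.image fun i => s(f i, i), ?_, fun v => ⟨s(f v, v),
    ⟨Finset.mem_image_of_mem _ (Finset.mem_univ v), Sym2.mem_mk_right _ _⟩, ?_⟩⟩
  · intro e he
    obtain ⟨i, -, rfl⟩ := Finset.mem_image.mp (Finset.mem_coe.mp he)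
    exact hG i
  · rintro e ⟨he, hv⟩
    obtain ⟨i, -, rfl⟩ := Finset.mem_image.mp he
    rcases Sym2.mem_iff.mp hv with rfl | rfl
    · rw [hf i, Sym2.eq_swap]
    · rfl

/-- A perfect matching determines an involution sending each vertex to its partner. -/
theorem IsPMFinset.exists_involutive {n : ℕ} {G : SimpleGraph (Fin n)}
    {M : Finset (Sym2 (Fin n))} (hM : IsPMFinset G M) :
    ∃ f : Fin n → Fin n, Function.Involutive f ∧
      ∀ i j, (G.Adj i j ∧ s(i, j) ∈ M) ↔ f i = j := by
  have key : ∀ i, ∃ j, s(i, j) ∈ M := fun i => by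
    obtain ⟨e, ⟨he, j, rfl⟩, -⟩ := hM.2 i
    exact ⟨j, he⟩
  choose f hf using key
  have huniq : ∀ i j, s(i, j) ∈ M → f i = j := fun i j h =>
    Sym2.congr_right.mp <|
      (hM.2 i).unique ⟨hf i, Sym2.mem_mk_left _ _⟩ ⟨h, Sym2.mem_mk_left _ _⟩
  refine ⟨f, fun i => huniq _ _ (Sym2.eq_swap ▸ hf i), fun i j => ⟨fun h => huniq i j h.2, ?_⟩⟩
  rintro rfl
  exact ⟨hM.1 (hf i), hf i⟩

/-- In characteristic 2, the determinant of a symmetric matrix vanishes as soon as every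
involutive permutation contributes zero to the Leibniz expansion. -/
theorem Matrix.IsSymm.det_eq_zero_of_charTwo {m R : Type*} [Fintype m] [DecidableEq m]
    [CommRing R] [CharP R 2] {A : Matrix m m R} (hA : A.IsSymm)
    (h : ∀ σ : Equiv.Perm m, Function.Involutive σ → ∏ i, A (σ i) i = 0) : A.det = 0 := by
  have hinv : ∀ σ : Equiv.Perm m, ∏ i, A (σ⁻¹ i) i = ∏ i, A (σ i) i := fun σ => by
    rw [← Equiv.prod_comp σ]
    exact Finset.prod_congr rfl fun i _ => by rw [Equiv.Perm.coe_inv, Equiv.symm_apply_apply, hA.apply]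
  rw [Matrix.det_apply]
  refine Finset.sum_involution (fun σ _ => σ⁻¹) (fun σ _ => ?_) (fun σ _ hσ heq => hσ ?_)
    (fun _ _ => Finset.mem_univ _) (fun σ _ => inv_inv σ)
  · rw [Equiv.Perm.sign_inv, hinv, CharTwo.add_self_eq_zero]
  · rw [h σ fun i => ?_, smul_zero]
    nth_rewrite 1 [← heq]
    exact σ.symm_apply_apply i

open scoped Classical in
theorem stmt_16 (F : Type*) [Field F] [CharP F 2] (n : ℕ) (G : SimpleGraph (Fin n)) :
    (Matrix.of fun i j : Fin n =>
        if G.Adj i j then (MvPolynomial.X s(i, j) : MvPolynomial (Sym2 (Fin n)) F)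
        else 0).det = 0 ↔
      ¬ ∃ M : Finset (Sym2 (Fin n)), IsPMFinset G M := by
  constructor
  · rintro hdet ⟨M, hM⟩
    obtain ⟨f, hf, hfM⟩ := hM.exists_involutive
    let φ : MvPolynomial (Sym2 (Fin n)) F →+* F :=
      MvPolynomial.eval fun e => if e ∈ M then 1 else 0
    have hφ := congrArg φ hdet
    rw [RingHom.map_det, map_zero] at hφ
    have hperm : φ.mapMatrix (Matrix.of fun i j : Fin n =>
        if G.Adj i j then (MvPolynomial.X s(i, j) : MvPolynomial (Sym2 (Fin n)) F) else 0) =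
        (hf.toPerm f).permMatrix F := by
      ext i j
      have hij := hfM i j
      by_cases h : G.Adj i j <;> by_cases h' : s(i, j) ∈ M <;>
        simp_all [φ, Equiv.Perm.permMatrix, PEquiv.toMatrix_apply]
    rw [hperm, Matrix.det_permutation] at hφ
    rcases Int.units_eq_one_or (Equiv.Perm.sign (hf.toPerm f)) with h | h <;> simp [h] at hφ
  · intro hG
    refine Matrix.IsSymm.det_eq_zero_of_charTwo ?_ fun σ hσ => ?_
    · refine Matrix.IsSymm.ext fun i j => ?_
      simp only [Matrix.of_apply, G.adj_comm j i, Sym2.eq_swap (a := j)]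
    · by_contra hne
      refine hG (exists_isPMFinset_of_involutive hσ fun i => ?_)
      by_contra hi
      exact hne (Finset.prod_eq_zero (Finset.mem_univ i) (if_neg hi))
end

section
/- Let G be a simple graph and f : V(G) → ℕ with f(v) ≤ deg_G(v) for every vertex v. Then G has an f-factor if and only if the f-blowup B_f(G) of G has a perfect matching. -/
/-- The vertices of the `f`-blowup of `G`: for each vertex `v` of `G` a set
`A(v)` of `f v` vertices (the left summand), and for each edge `e` of `G` and each
endpoint `v` of `e` a vertex `v_e` (the right summand). -/
def BlowupVertex {V : Type*} (G : SimpleGraph V) (f : V → ℕ) : Type _ :=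
  (Σ v : V, Fin (f v)) ⊕ {p : V × Sym2 V // p.2 ∈ G.edgeSet ∧ p.1 ∈ p.2}

/-- The `f`-blowup of `G`: for every edge `e = {v, w}` of `G`, the vertex `v_e` is joined
to every vertex of `A(v)`, the vertex `w_e` is joined to every vertex of `A(w)`, and
`v_e` is joined to `w_e`. -/
def Blowup {V : Type*} (G : SimpleGraph V) (f : V → ℕ) :
    SimpleGraph (BlowupVertex G f) :=
  SimpleGraph.fromRel fun a b =>
    match a, b with
    | Sum.inl ⟨v, _⟩, Sum.inr ⟨(w, _), _⟩ => v = w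
    | Sum.inr ⟨(_, e), _⟩, Sum.inr ⟨(_, e'), _⟩ => e = e'
    | _, _ => False

theorem SimpleGraph.exists_isPerfectMatching_iff_exists_involutive {W : Type*}
    (G : SimpleGraph W) :
    (∃ M : G.Subgraph, M.IsPerfectMatching) ↔
      ∃ m : W → W, Function.Involutive m ∧ ∀ x, G.Adj x (m x) := by
  constructor
  · rintro ⟨M, hM⟩
    rw [SimpleGraph.Subgraph.isPerfectMatching_iff] at hM
    choose m hm hu using hM
    exact ⟨m, fun x => (hu (m x) x (hm x).symm).symm, fun x => (hm x).adj_sub⟩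
  · rintro ⟨m, hm, hadj⟩
    refine ⟨{ verts := Set.univ
              Adj := fun x y => m x = y
              adj_sub := fun {x y} h => h ▸ hadj x
              edge_vert := fun _ => trivial
              symm := ⟨fun x y h => h ▸ hm x⟩ }, ?_⟩
    rw [SimpleGraph.Subgraph.isPerfectMatching_iff]
    exact fun x => ⟨m x, rfl, fun y hy => Eq.symm hy⟩

theorem SimpleGraph.ncard_neighborSet_eq_card_incidenceSet {V : Type*}
    (G : SimpleGraph V) (v : V) :
    (G.neighborSet v).ncard = Nat.card (G.incidenceSet v) := by
  classical
  exact (Nat.card_congr (G.incidenceSetEquivNeighborSet v)).symm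

section Blowup

variable {V : Type*} {G : SimpleGraph V} {f : V → ℕ}

/-- The vertex `v_e` of the blowup. -/
def BlowupVertex.port (v : V) (e : Sym2 V) (he : e ∈ G.edgeSet) (hv : v ∈ e) :
    BlowupVertex G f :=
  Sum.inr ⟨(v, e), he, hv⟩

/-- The `i`-th vertex of the set `A(v)` of the blowup. -/
def BlowupVertex.core (v : V) (i : Fin (f v)) : BlowupVertex G f :=
  Sum.inl ⟨v, i⟩

open BlowupVertex

theorem BlowupVertex.cases (x : BlowupVertex G f) :
    (∃ v i, x = core v i) ∨ ∃ v e he hv, x = port v e he hv := by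
  obtain ⟨v, i⟩ | ⟨⟨v, e⟩, he, hv⟩ := x
  · exact Or.inl ⟨v, i, rfl⟩
  · exact Or.inr ⟨v, e, he, hv, rfl⟩

theorem BlowupVertex.core_ne_port {v w : V} {i : Fin (f v)} {e : Sym2 V}
    {he : e ∈ G.edgeSet} {hw : w ∈ e} :
    (core v i : BlowupVertex G f) ≠ port w e he hw :=
  Sum.inl_ne_inr

theorem BlowupVertex.core_injective (v : V) :
    Function.Injective (core v : Fin (f v) → BlowupVertex G f) := by
  intro i j h
  exact eq_of_heq (Sigma.mk.inj (Sum.inl.inj h)).2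

theorem BlowupVertex.port_inj {v w : V} {e e' : Sym2 V} {he : e ∈ G.edgeSet} {hv : v ∈ e}
    {he' : e' ∈ G.edgeSet} {hw : w ∈ e'} :
    (port v e he hv : BlowupVertex G f) = port w e' he' hw ↔ v = w ∧ e = e' := by
  refine ⟨fun h => ?_, ?_⟩
  · exact Prod.mk.inj (congrArg Subtype.val (Sum.inr.inj h))
  · rintro ⟨rfl, rfl⟩
    rfl

theorem blowup_adj_core_port {v w : V} {i : Fin (f v)} {e : Sym2 V}
    {he : e ∈ G.edgeSet} {hw : w ∈ e} :
    (Blowup G f).Adj (core v i) (port w e he hw) ↔ v = w := by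
  refine (SimpleGraph.fromRel_adj ..).trans ⟨?_, fun h => ⟨core_ne_port, Or.inl h⟩⟩
  rintro ⟨-, h | h⟩
  · exact h
  · exact h.elim

theorem blowup_not_adj_core_core {v w : V} {i : Fin (f v)} {j : Fin (f w)} :
    ¬ (Blowup G f).Adj (core v i) (core w j) := by
  intro h
  obtain ⟨-, h | h⟩ := (SimpleGraph.fromRel_adj ..).1 h <;> exact h

theorem blowup_adj_port_port {v w : V} {e e' : Sym2 V} {he : e ∈ G.edgeSet} {hv : v ∈ e}
    {he' : e' ∈ G.edgeSet} {hw : w ∈ e'} :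
    (Blowup G f).Adj (port v e he hv) (port w e' he' hw) ↔ v ≠ w ∧ e = e' := by
  refine (SimpleGraph.fromRel_adj ..).trans ⟨?_, fun ⟨hne, h⟩ =>
    ⟨fun h' => hne (port_inj.1 h').1, Or.inl h⟩⟩
  rintro ⟨hne, h⟩
  have hee : e = e' := h.elim id Eq.symm
  exact ⟨fun hvw => hne (port_inj.2 ⟨hvw, hee⟩), hee⟩

theorem exists_eq_port_of_blowup_adj_core {v : V} {i : Fin (f v)} {x : BlowupVertex G f}
    (h : (Blowup G f).Adj (core v i) x) : ∃ e he hv, x = port v e he hv := by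
  obtain ⟨w, j, rfl⟩ | ⟨w, e, he, hw, rfl⟩ := x.cases
  · exact absurd h blowup_not_adj_core_core
  · obtain rfl := blowup_adj_core_port.1 h
    exact ⟨e, he, hw, rfl⟩

theorem blowup_adj_port_cases {v : V} {e : Sym2 V} {he : e ∈ G.edgeSet} {hv : v ∈ e}
    {x : BlowupVertex G f} (h : (Blowup G f).Adj (port v e he hv) x) :
    (∃ i, x = core v i) ∨ ∃ w, ∃ hw : w ∈ e, v ≠ w ∧ x = port w e he hw := by
  obtain ⟨w, j, rfl⟩ | ⟨w, e', he', hw, rfl⟩ := x.cases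
  · obtain rfl := blowup_adj_core_port.1 h.symm
    exact Or.inl ⟨j, rfl⟩
  · obtain ⟨hne, rfl⟩ := blowup_adj_port_port.1 h
    exact Or.inr ⟨w, hw, hne, rfl⟩

theorem IsFFactor.exists_involutive [Finite V] {H : SimpleGraph V} (hH : IsFFactor G H f) :
    ∃ m : BlowupVertex G f → BlowupVertex G f,
      Function.Involutive m ∧ ∀ x, (Blowup G f).Adj x (m x) := by
  classical
  obtain ⟨hle, hdeg⟩ := hH
  have hedge : H.edgeSet ⊆ G.edgeSet := SimpleGraph.edgeSet_mono hle
  have φ (v : V) : Fin (f v) ≃ H.incidenceSet v :=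
    (Finite.equivFinOfCardEq
      ((H.ncard_neighborSet_eq_card_incidenceSet v).symm.trans (hdeg v))).symm
  have hφ (v i) : (φ v i : Sym2 V) ∈ H.edgeSet ∧ v ∈ (φ v i : Sym2 V) := (φ v i).2
  let m : BlowupVertex G f → BlowupVertex G f :=
    Sum.elim
      (fun x => port x.1 (φ x.1 x.2) (hedge (hφ x.1 x.2).1) (hφ x.1 x.2).2)
      (fun p => if h : p.1.2 ∈ H.edgeSet then core p.1.1 ((φ p.1.1).symm ⟨p.1.2, h, p.2.2⟩)
        else port (Sym2.Mem.other p.2.2) p.1.2 p.2.1 (Sym2.other_mem p.2.2))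
  have m_core (v i) : m (core v i) = port v (φ v i) (hedge (hφ v i).1) (hφ v i).2 := rfl
  have m_port {v e} (he : e ∈ G.edgeSet) (hv : v ∈ e) :
      m (port v e he hv) =
        if h : e ∈ H.edgeSet then core v ((φ v).symm ⟨e, h, hv⟩)
        else port (Sym2.Mem.other hv) e he (Sym2.other_mem hv) := rfl
  have m_port_of_mem {v e} (he : e ∈ G.edgeSet) (hv : v ∈ e) (h : e ∈ H.edgeSet) :
      m (port v e he hv) = core v ((φ v).symm ⟨e, h, hv⟩) := by
    rw [m_port, dif_pos h]
  have m_port_of_notMem {v e} (he : e ∈ G.edgeSet) (hv : v ∈ e) (h : e ∉ H.edgeSet) :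
      m (port v e he hv) = port (Sym2.Mem.other hv) e he (Sym2.other_mem hv) := by
    rw [m_port, dif_neg h]
  refine ⟨m, fun x => ?_, fun x => ?_⟩ <;>
    obtain ⟨v, i, rfl⟩ | ⟨v, e, he, hv, rfl⟩ := x.cases
  · rw [m_core, m_port_of_mem _ _ (hφ v i).1]
    exact congrArg (core v) ((φ v).symm_apply_apply i)
  · by_cases h : e ∈ H.edgeSet
    · rw [m_port_of_mem he hv h, m_core, port_inj]
      simp
    · rw [m_port_of_notMem he hv h, m_port_of_notMem _ _ h, port_inj]
      exact ⟨Sym2.other_invol hv _, rfl⟩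
  · rw [m_core, blowup_adj_core_port]
  · by_cases h : e ∈ H.edgeSet
    · rw [m_port_of_mem he hv h, SimpleGraph.adj_comm, blowup_adj_core_port]
    · rw [m_port_of_notMem he hv h, blowup_adj_port_port]
      exact ⟨(Sym2.other_ne (G.not_isDiag_of_mem_edgeSet he) hv).symm, rfl⟩

theorem exists_isFFactor_of_involutive {m : BlowupVertex G f → BlowupVertex G f}
    (hm : Function.Involutive m) (hadj : ∀ x, (Blowup G f).Adj x (m x)) :
    ∃ H : SimpleGraph V, IsFFactor G H f := by
  let S : Set (Sym2 V) :=
    {e | ∃ he : e ∈ G.edgeSet, ∀ v (hv : v ∈ e), ∃ i, m (port v e he hv) = core v i}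
  have hS : S ⊆ G.edgeSet := fun e he => he.1
  have mem_edgeSet (e : Sym2 V) : e ∈ (SimpleGraph.fromEdgeSet S).edgeSet ↔ e ∈ S := by
    rw [SimpleGraph.edgeSet_fromEdgeSet]
    exact ⟨fun h => h.1, fun h => ⟨h, G.not_isDiag_of_mem_edgeSet (hS h)⟩⟩
  have mem_S {v e} (he : e ∈ G.edgeSet) (hv : v ∈ e) {i : Fin (f v)}
      (h : m (port v e he hv) = core v i) : e ∈ S := by
    refine ⟨he, fun w hw => ?_⟩
    obtain hi | ⟨u, hu, hne, hmw⟩ := blowup_adj_port_cases (hadj (port w e he hw))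
    · exact hi
    · have hmu : m (port u e he hu) = port w e he hw := by rw [← hmw, hm]
      have huw : e = s(w, u) := (Sym2.mem_and_mem_iff hne).1 ⟨hw, hu⟩
      obtain rfl | rfl : v = w ∨ v = u := by simpa [huw] using hv
      · exact ⟨i, h⟩
      · exact absurd (h.symm.trans hmu) core_ne_port
  refine ⟨SimpleGraph.fromEdgeSet S, ?_, fun v => ?_⟩
  · rw [← SimpleGraph.edgeSet_subset_edgeSet]
    exact fun e he => hS ((mem_edgeSet e).1 he)
  · choose e he hv hme using fun i : Fin (f v) =>
      exists_eq_port_of_blowup_adj_core (hadj (core v i))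
    have hm_port (i) : m (port v (e i) (he i) (hv i)) = core v i := by rw [← hme, hm]
    let g : Fin (f v) → (SimpleGraph.fromEdgeSet S).incidenceSet v := fun i =>
      ⟨e i, (mem_edgeSet _).2 (mem_S (he i) (hv i) (hm_port i)), hv i⟩
    have hg : Function.Bijective g := by
      constructor
      · intro i j hij
        apply core_injective (G := G) v
        apply hm.injective
        rw [hme, hme, port_inj]
        exact ⟨rfl, congrArg Subtype.val hij⟩
      · rintro ⟨e', he', hv'⟩
        obtain ⟨heG, hcore⟩ := (mem_edgeSet e').1 he'
        obtain ⟨i, hi⟩ := hcore v hv'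
        refine ⟨i, Subtype.ext ?_⟩
        have : m (core v i) = port v e' heG hv' := by rw [← hi, hm]
        exact (port_inj.1 ((hme i).symm.trans this)).2
    rw [SimpleGraph.ncard_neighborSet_eq_card_incidenceSet, ← Nat.card_eq_of_bijective g hg,
      Nat.card_fin]

end Blowup

theorem stmt_17 {V : Type*} [Fintype V] [DecidableEq V] (G : SimpleGraph V) (f : V → ℕ)
    (hf : ∀ v : V, f v ≤ (G.neighborSet v).ncard) :
    (∃ H : SimpleGraph V, IsFFactor G H f) ↔
      ∃ M : (Blowup G f).Subgraph, M.IsPerfectMatching := by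
  rw [SimpleGraph.exists_isPerfectMatching_iff_exists_involutive]
  exact ⟨fun ⟨_, hH⟩ => hH.exists_involutive,
    fun ⟨_, hm, hadj⟩ => exists_isFFactor_of_involutive hm hadj⟩
end

section
/- Let G be a simple graph on z ≥ 3 vertices and let k ≥ 2 be an integer. Let G' be the simple graph obtained from G by adding, for each vertex v of G, a clique C_v on k − 1 new vertices and making every vertex of C_v adjacent to v (the sets C_v for distinct v are pairwise disjoint and there are no other new edges). Define f : V(G') → ℕ by f(x) = k − 1 for every x in any C_v, and f(v) = k + 1 for every v ∈ V(G). Then G has a Hamiltonian cycle if and only if G' has a connected f-factor. -/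
/-- The graph `G'` obtained from `G` by attaching to every vertex `v` of `G` a clique
`C_v` on `k - 1` new vertices (the vertices `(v, i)` of the right summand), each of whose
vertices is adjacent to `v`. -/
def AttachCliques {V : Type*} (G : SimpleGraph V) (k : ℕ) :
    SimpleGraph (V ⊕ V × Fin (k - 1)) :=
  SimpleGraph.fromRel fun a b =>
    match a, b with
    | Sum.inl u, Sum.inl v => G.Adj u v
    | Sum.inl u, Sum.inr (v, _) => u = v
    | Sum.inr (u, _), Sum.inr (v, _) => u = v
    | _, _ => False

namespace AttachCliques

variable {V : Type*} {G : SimpleGraph V} {k : ℕ}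

@[simp]
lemma adj_inl_inl {u v : V} :
    (AttachCliques G k).Adj (Sum.inl u) (Sum.inl v) ↔ G.Adj u v := by
  simp only [AttachCliques, SimpleGraph.fromRel_adj, ne_eq, Sum.inl.injEq, G.adj_comm v u, or_self,
    and_iff_right_iff_imp]
  exact SimpleGraph.Adj.ne

@[simp]
lemma adj_inl_inr {u : V} {p : V × Fin (k - 1)} :
    (AttachCliques G k).Adj (Sum.inl u) (Sum.inr p) ↔ u = p.1 := by
  simp [AttachCliques]

@[simp]
lemma adj_inr_inl {u : V} {p : V × Fin (k - 1)} :
    (AttachCliques G k).Adj (Sum.inr p) (Sum.inl u) ↔ u = p.1 := by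
  simp [AttachCliques]

@[simp]
lemma adj_inr_inr {p q : V × Fin (k - 1)} :
    (AttachCliques G k).Adj (Sum.inr p) (Sum.inr q) ↔ p ≠ q ∧ p.1 = q.1 := by
  simp [AttachCliques, eq_comm]

lemma inr_mk_injective (v : V) :
    Function.Injective fun i : Fin (k - 1) => (Sum.inr (v, i) : V ⊕ V × Fin (k - 1)) :=
  Sum.inr_injective.comp (Prod.mk_right_injective v)

lemma neighborSet_inl (v : V) :
    (AttachCliques G k).neighborSet (Sum.inl v) =
      Sum.inl '' G.neighborSet v ∪ Set.range fun i => Sum.inr (v, i) := by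
  ext (u | ⟨u, i⟩) <;> simp

lemma neighborSet_inr (v : V) (i : Fin (k - 1)) :
    (AttachCliques G k).neighborSet (Sum.inr (v, i)) =
      insert (Sum.inl v) ((fun j => Sum.inr (v, j)) '' {i}ᶜ) := by
  ext (u | ⟨u, j⟩)
  · simp
  · simp only [SimpleGraph.mem_neighborSet, adj_inr_inr, Set.mem_insert_iff, Set.mem_image]
    grind

lemma ncard_neighborSet_inl [Finite V] (v : V) :
    ((AttachCliques G k).neighborSet (Sum.inl v)).ncard =
      (G.neighborSet v).ncard + (k - 1) := by
  rw [neighborSet_inl, Set.ncard_union_eq _ (Set.toFinite _) (Set.toFinite _),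
    Set.ncard_image_of_injective _ Sum.inl_injective, ← Set.image_univ,
    Set.ncard_image_of_injective _ (inr_mk_injective v),
    Set.ncard_univ, Nat.card_eq_fintype_card, Fintype.card_fin]
  rw [Set.disjoint_left]
  rintro _ ⟨u, -, rfl⟩
  simp

lemma ncard_neighborSet_inr (p : V × Fin (k - 1)) :
    ((AttachCliques G k).neighborSet (Sum.inr p)).ncard = k - 1 := by
  obtain ⟨v, i⟩ := p
  have hi := i.pos
  rw [neighborSet_inr, Set.ncard_insert_of_notMem (by simp) (Set.toFinite _),
    Set.ncard_image_of_injective _ (inr_mk_injective v),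
    Set.ncard_compl, Set.ncard_singleton, Nat.card_eq_fintype_card, Fintype.card_fin]
  omega

lemma connected_iff : (AttachCliques G k).Connected ↔ G.Connected := by
  let proj : V ⊕ V × Fin (k - 1) → V := Sum.elim id Prod.fst
  constructor
  · intro h
    obtain ⟨x⟩ := h.nonempty
    refine { preconnected := fun u v => ?_, nonempty := ⟨proj x⟩ }
    have key : ∀ {x y} (_ : (AttachCliques G k).Walk x y), G.Reachable (proj x) (proj y) := by
      intro x y w
      induction w with
      | nil => rfl
      | @cons x y z hxy _ ih =>
        refine .trans ?_ ih
        rcases x with x | x <;> rcases y with y | y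
        · exact (adj_inl_inl.1 hxy).reachable
        · simp only [adj_inl_inr] at hxy; subst hxy; rfl
        · simp only [adj_inr_inl] at hxy; subst hxy; rfl
        · rw [adj_inr_inr] at hxy
          change G.Reachable x.1 y.1
          rw [hxy.2]
    obtain ⟨w⟩ := h.preconnected (Sum.inl u) (Sum.inl v)
    exact key w
  · intro h
    obtain ⟨v⟩ := h.nonempty
    have key : ∀ x, (AttachCliques G k).Reachable (Sum.inl v) x := by
      have hl : ∀ u, (AttachCliques G k).Reachable (Sum.inl v) (Sum.inl u) := fun u =>
        (h.preconnected v u).map (⟨Sum.inl, adj_inl_inl.2⟩ : G →g AttachCliques G k)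
      rintro (u | p)
      · exact hl u
      · exact (hl p.1).trans (adj_inl_inr.2 rfl).reachable
    exact { preconnected := fun x y => (key x).symm.trans (key y), nonempty := ⟨Sum.inl v⟩ }

lemma mono {K : SimpleGraph V} (h : K ≤ G) : AttachCliques K k ≤ AttachCliques G k := by
  rintro (u | p) (v | q) <;> simp
  exact fun huv => h huv

/-- A spanning subgraph of `AttachCliques G k` of degree `k - 1` at the new vertices contains all
edges at the new vertices. -/
lemma eq_attachCliques_comap [Finite V] {H : SimpleGraph (V ⊕ V × Fin (k - 1))}
    (hle : H ≤ AttachCliques G k)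
    (hdeg : ∀ p, (H.neighborSet (Sum.inr p)).ncard = k - 1) :
    H = AttachCliques (H.comap Sum.inl) k := by
  have hset : ∀ p, H.neighborSet (Sum.inr p) = (AttachCliques G k).neighborSet (Sum.inr p) :=
    fun p => Set.eq_of_subset_of_ncard_le (fun _ hx => hle hx)
      (by rw [hdeg, ncard_neighborSet_inr]) (Set.toFinite _)
  have key : ∀ p x, H.Adj (Sum.inr p) x ↔ (AttachCliques G k).Adj (Sum.inr p) x :=
    fun p => Set.ext_iff.1 (hset p)
  ext (u | p) (v | q)
  · simp
  · rw [H.adj_comm, key]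
    simp
  · rw [key]
    simp
  · rw [key]
    simp

end AttachCliques

lemma SimpleGraph.exists_isHamiltonianCycle_iff_exists_two_regular_connected {V : Type*}
    [Fintype V] [DecidableEq V] (G : SimpleGraph V) :
    (∃ (v : V) (w : G.Walk v v), w.IsHamiltonianCycle) ↔
      ∃ K ≤ G, (∀ v, (K.neighborSet v).ncard = 2) ∧ K.Connected := by
  constructor
  · rintro ⟨v, w, hw⟩
    have hverts : ∀ u, u ∈ w.toSubgraph.verts := fun u =>
      w.mem_verts_toSubgraph.2 (hw.mem_support u)
    refine ⟨w.toSubgraph.spanningCoe, w.toSubgraph.spanningCoe_le,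
      fun u => hw.isCycle.ncard_neighborSet_toSubgraph_eq_two (hw.mem_support u), ?_⟩
    exact (w.toSubgraph.spanningCoeEquivCoeOfSpanning hverts).connected_iff.2
      w.toSubgraph_connected.coe
  · rintro ⟨K, hKG, hdeg, hconn⟩
    obtain ⟨v⟩ := hconn.nonempty
    have hv : (K.neighborSet v).Nonempty := Set.nonempty_of_ncard_ne_zero (by simp [hdeg])
    obtain ⟨p, hp, hverts⟩ :=
      IsCycles.exists_cycle_toSubgraph_verts_eq_connectedComponentSupp
        (c := K.connectedComponentMk v) (fun u _ => hdeg u) rfl hv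
    have hmem : ∀ u, u ∈ p.support := fun u => by
      rw [← p.mem_verts_toSubgraph, hverts]
      exact ConnectedComponent.sound (hconn.preconnected u v)
    have hham : p.IsHamiltonianCycle := by
      refine ⟨hp, hp.isPath_tail.isHamiltonian_of_mem fun u => ?_⟩
      rw [Walk.support_tail_of_not_nil _ hp.not_nil]
      have := hmem u
      rw [Walk.mem_support_iff] at this
      rcases this with rfl | h
      · exact p.end_mem_tail_support hp.not_nil
      · exact h
    exact ⟨v, p.map (.ofLE hKG), hham.map Function.bijective_id⟩

theorem stmt_18 {V : Type*} [Fintype V] [DecidableEq V] (G : SimpleGraph V)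
    (hz : 3 ≤ Fintype.card V) (k : ℕ) (hk : 2 ≤ k) :
    (∃ (v : V) (w : G.Walk v v), w.IsHamiltonianCycle) ↔
      ∃ H : SimpleGraph (V ⊕ V × Fin (k - 1)),
        IsFFactor (AttachCliques G k) H
          (Sum.elim (fun _ => k + 1) (fun _ => k - 1)) ∧ H.Connected := by
  rw [G.exists_isHamiltonianCycle_iff_exists_two_regular_connected]
  constructor
  · rintro ⟨K, hKG, hdeg, hconn⟩
    refine ⟨AttachCliques K k, ⟨AttachCliques.mono hKG, ?_⟩, AttachCliques.connected_iff.2 hconn⟩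
    rintro (v | p)
    · rw [AttachCliques.ncard_neighborSet_inl, hdeg, Sum.elim_inl]
      omega
    · exact AttachCliques.ncard_neighborSet_inr p
  · rintro ⟨H, ⟨hle, hdeg⟩, hconn⟩
    have hH := AttachCliques.eq_attachCliques_comap hle fun p => hdeg (Sum.inr p)
    refine ⟨H.comap Sum.inl, fun u v h => AttachCliques.adj_inl_inl.1 (hle h), fun v => ?_, ?_⟩
    · have h := hdeg (Sum.inl v)
      rw [hH, AttachCliques.ncard_neighborSet_inl, Sum.elim_inl] at h
      omega
    · exact AttachCliques.connected_iff.1 (hH ▸ hconn)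
end
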